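/- arXiv:1406.5061 — 9 statements merged into one kernel-verified Lean document; each statement's English description precedes it below -/
import Mathlib

section
/- There is no symmetric 5-ary polymorphism of the relational structure K. That is, there is no function f : (Fin 5 → K) → K such that f(x ∘ σ) = f(x) for every permutation σ of Fin 5 and every x : Fin 5 → K, and such that f(r ∘ x) = r(f(x)) and f(s ∘ x) = s(f(x)) for all x : Fin 5 → K. -/
/-- The 21-element universe of the relational structure `K`. -/
inductive K : Type
  | k0 | k1 | k2 | k3 | k4 | k5 | k6 | k7 | k8 | k9 | k10
  | p01 | p02 | p03 | p04 | p12 | p13 | p14 | p23 | p24 | p34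
  deriving DecidableEq

open K

/-- The permutation `r = (0 1 2)(5 6 7)(8 9 10)(p12 p02 p01)(p04 p14 p24)(p13 p23 p03)`. -/
def r : K → K
  | k0 => k1 | k1 => k2 | k2 => k0
  | k3 => k3 | k4 => k4
  | k5 => k6 | k6 => k7 | k7 => k5
  | k8 => k9 | k9 => k10 | k10 => k8
  | p12 => p02 | p02 => p01 | p01 => p12
  | p04 => p14 | p14 => p24 | p24 => p04
  | p13 => p23 | p23 => p03 | p03 => p13
  | p34 => p34

/-- The permutation `s = (1 4)(2 3)(5 6)(7 8)(p34 p12)(p02 p03)(p01 p04)(p24 p13)`. -/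
def s : K → K
  | k0 => k0
  | k1 => k4 | k4 => k1
  | k2 => k3 | k3 => k2
  | k5 => k6 | k6 => k5
  | k7 => k8 | k8 => k7
  | k9 => k9 | k10 => k10
  | p34 => p12 | p12 => p34
  | p02 => p03 | p03 => p02
  | p01 => p04 | p04 => p01
  | p24 => p13 | p13 => p24
  | p14 => p14 | p23 => p23

/-- The permutations `r` and `s` have no common fixed point. -/
theorem not_common_fixed_point (a : K) : ¬ (r a = a ∧ s a = a) := by
  cases a <;> decide

/-- The relational structure `K` (with the graphs of `r` and `s` as relations)
has no symmetric 5-ary polymorphism. -/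
theorem K_no_symmetric_5ary_polymorphism :
    ¬ ∃ f : (Fin 5 → K) → K,
      (∀ (σ : Equiv.Perm (Fin 5)) (x : Fin 5 → K), f (x ∘ σ) = f x) ∧
      (∀ x : Fin 5 → K, f (r ∘ x) = r (f x)) ∧
      (∀ x : Fin 5 → K, f (s ∘ x) = s (f x)) := by
  rintro ⟨f, hsymm, hr, hs⟩
  -- Both `r` and `s` permute the entries of `(0, 1, 2, 3, 4)`.
  let x : Fin 5 → K := ![k0, k1, k2, k3, k4]
  have hrx : r ∘ x = x ∘ (Equiv.swap 0 1 * Equiv.swap 1 2 : Equiv.Perm (Fin 5)) := by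
    funext i
    fin_cases i <;> decide
  have hsx : s ∘ x = x ∘ (Equiv.swap 1 4 * Equiv.swap 2 3 : Equiv.Perm (Fin 5)) := by
    funext i
    fin_cases i <;> decide
  refine not_common_fixed_point (f x) ⟨?_, ?_⟩
  · rw [← hr, hrx, hsymm]
  · rw [← hs, hsx, hsymm]
end

section
/- For every natural number n ≥ 2, the relational structure K has an n-ary cyclic polymorphism: there exists f : (Fin n → K) → K such that f(x ∘ c) = f(x) for all x : Fin n → K, where c is the cyclic shift permutation of Fin n, and such that f(r ∘ x) = r(f(x)) and f(s ∘ x) = s(f(x)) for all x : Fin n → K. -/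
open K

/-- If every stabilizer in `X` is contained in a stabilizer in `Y`, there is an equivariant map. -/
theorem exists_equivariant_map {M X Y : Type*} [Group M] [MulAction M X] [MulAction M Y]
    (h : ∀ x : X, ∃ y : Y, MulAction.stabilizer M x ≤ MulAction.stabilizer M y) :
    ∃ f : X → Y, ∀ (m : M) (x : X), f (m • x) = m • f x := by
  choose p hp using h
  let rep : X → X := fun x => (Quotient.mk (MulAction.orbitRel M X) x).out
  have hrep : ∀ x, ∃ m : M, m • rep x = x := fun x =>
    (MulAction.orbitRel M X).symm (Quotient.mk_out (s := MulAction.orbitRel M X) x)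
  choose t ht using hrep
  refine ⟨fun x => t x • p (rep x), fun m x => ?_⟩
  have hr : rep (m • x) = rep x :=
    congrArg Quotient.out (Quotient.sound (s := MulAction.orbitRel M X) ⟨m, rfl⟩)
  have hmem : (m * t x)⁻¹ * t (m • x) ∈ MulAction.stabilizer M (rep x) := by
    rw [MulAction.mem_stabilizer_iff, mul_smul, inv_smul_eq_iff, mul_smul, ht, ← hr, ht]
  have hfix := hp _ hmem
  rw [MulAction.mem_stabilizer_iff, mul_smul, inv_smul_eq_iff, mul_smul] at hfix
  simpa only [hr] using hfix

theorem perm_apply_inv_apply {α : Type*} (e : Equiv.Perm α) (a : α) : e (e⁻¹ a) = a :=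
  e.apply_symm_apply a

namespace K

instance : Fintype K where
  elems := {k0, k1, k2, k3, k4, k5, k6, k7, k8, k9, k10,
    p01, p02, p03, p04, p12, p13, p14, p23, p24, p34}
  complete x := by cases x <;> decide

/-- The permutation `r` as an equivalence. -/
def rPerm : Equiv.Perm K := ⟨r, r ∘ r, by decide, by decide⟩

/-- The permutation `s` as an equivalence. -/
def sPerm : Equiv.Perm K := ⟨s, s, by decide, by decide⟩

/-- The group generated by `r` and `s`, isomorphic to the alternating group on `0, …, 4`. -/
def symmetryGroup : Subgroup (Equiv.Perm K) := Subgroup.closure {rPerm, sPerm}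

/-- The index of the orbit of an element of `K`. -/
def orbitIndex : K → Fin 3
  | k0 | k1 | k2 | k3 | k4 => 0
  | k5 | k6 | k7 | k8 | k9 | k10 => 1
  | _ => 2

/-- A conjugate of `s` fixing `3`. -/
def conjS : K → K := s ∘ r ∘ r ∘ s ∘ r ∘ s

/-- Normal forms for the elements of the group generated by `r` and `s`: a power of the
5-cycle `r ∘ s` times an element of the stabilizer of `3`. -/
def normalForm (i : Fin 5) (j : Fin 3) (k l : Fin 2) : K → K :=
  (r ∘ s)^[i] ∘ r^[j] ∘ conjS^[k] ∘ (r ∘ conjS ∘ r ∘ r)^[l]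

theorem exists_normalForm_r_comp : ∀ i j k l, ∃ i' j' k' l', ∀ a,
    r (normalForm i j k l a) = normalForm i' j' k' l' a := by
  decide +kernel

theorem exists_normalForm_s_comp : ∀ i j k l, ∃ i' j' k' l', ∀ a,
    s (normalForm i j k l a) = normalForm i' j' k' l' a := by
  decide +kernel

theorem exists_normalForm {g : Equiv.Perm K} (hg : g ∈ symmetryGroup) :
    ∃ i j k l, ∀ a, g a = normalForm i j k l a := by
  have step_r : ∀ g : Equiv.Perm K, (∃ i j k l, ∀ a, g a = normalForm i j k l a) →
      ∃ i j k l, ∀ a, (rPerm * g) a = normalForm i j k l a := by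
    rintro g ⟨i, j, k, l, h⟩
    obtain ⟨i', j', k', l', h'⟩ := exists_normalForm_r_comp i j k l
    exact ⟨i', j', k', l', fun a => (congrArg r (h a)).trans (h' a)⟩
  have step_s : ∀ g : Equiv.Perm K, (∃ i j k l, ∀ a, g a = normalForm i j k l a) →
      ∃ i j k l, ∀ a, (sPerm * g) a = normalForm i j k l a := by
    rintro g ⟨i, j, k, l, h⟩
    obtain ⟨i', j', k', l', h'⟩ := exists_normalForm_s_comp i j k l
    exact ⟨i', j', k', l', fun a => (congrArg s (h a)).trans (h' a)⟩
  induction hg using Subgroup.closure_induction_left with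
  | one => exact ⟨0, 0, 0, 0, fun _ => rfl⟩
  | mul_left x hx y _ ih =>
    rcases hx with rfl | rfl
    exacts [step_r _ ih, step_s _ ih]
  | inv_mul_cancel x hx y _ ih =>
    rcases hx with rfl | rfl
    · exact step_r _ (step_r _ ih)
    · exact step_s _ ih

theorem orbitIndex_normalForm : ∀ i j k l a,
    orbitIndex (normalForm i j k l a) = orbitIndex a := by
  decide +kernel

theorem normalForm_unique_fixed : ∀ i j k l, (∃ a, normalForm i j k l a ≠ a) →
    ∃ p, normalForm i j k l p = p ∧
      ∀ q, normalForm i j k l q = q → orbitIndex q = orbitIndex p → q = p := by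
  decide +kernel

theorem normalForm_fixed_of_fixed : ∀ i j k l a, normalForm i j k l a = a →
    ∀ b, orbitIndex b = orbitIndex a → b ≠ a → normalForm i j k l b = b →
    (∃ c, normalForm i j k l c ≠ c) →
    ∀ i' j' k' l', normalForm i' j' k' l' a = a → normalForm i' j' k' l' b = b →
    (∃ c, normalForm i' j' k' l' c ≠ c) →
    ∀ c, normalForm i j k l c = c → normalForm i' j' k' l' c = c := by
  decide +kernel

theorem orbitIndex_apply {g : Equiv.Perm K} (hg : g ∈ symmetryGroup) (a : K) :
    orbitIndex (g a) = orbitIndex a := by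
  obtain ⟨i, j, k, l, h⟩ := exists_normalForm hg
  rw [h, orbitIndex_normalForm]

/-- A nontrivial symmetry has exactly one fixed point in some orbit. -/
theorem exists_unique_fixed_in_orbit {g : Equiv.Perm K} (hg : g ∈ symmetryGroup) (hne : g ≠ 1) :
    ∃ p, g p = p ∧ ∀ q, g q = q → orbitIndex q = orbitIndex p → q = p := by
  obtain ⟨i, j, k, l, h⟩ := exists_normalForm hg
  obtain ⟨a, ha⟩ := not_forall.1 (mt Equiv.ext hne)
  simp only [h]
  exact normalForm_unique_fixed i j k l ⟨a, h a ▸ ha⟩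

/-- Nontrivial symmetries fixing the same two points of one orbit have the same fixed points. -/
theorem fixed_of_fixed {g g' : Equiv.Perm K} (hg : g ∈ symmetryGroup) (hne : g ≠ 1)
    (hg' : g' ∈ symmetryGroup) (hne' : g' ≠ 1) {a b : K} (hab : orbitIndex b = orbitIndex a)
    (hba : b ≠ a) (ha : g a = a) (hb : g b = b) (ha' : g' a = a) (hb' : g' b = b) {c : K}
    (hc : g c = c) : g' c = c := by
  obtain ⟨i, j, k, l, h⟩ := exists_normalForm hg
  obtain ⟨i', j', k', l', h'⟩ := exists_normalForm hg'
  obtain ⟨d, hd⟩ := not_forall.1 (mt Equiv.ext hne)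
  obtain ⟨d', hd'⟩ := not_forall.1 (mt Equiv.ext hne')
  rw [h] at ha hb hc
  rw [h'] at ha' hb' ⊢
  exact normalForm_fixed_of_fixed i j k l a ha b hab hba hb ⟨d, h d ▸ hd⟩ i' j' k' l' ha' hb'
    ⟨d', h' d' ▸ hd'⟩ c hc

/-- The symmetries acting on a tuple as a commuting family of coordinate permutations have a
common fixed point. -/
theorem exists_common_fixed {ι : Type*} [Nonempty ι] (C : Subgroup (Equiv.Perm ι))
    (hC : ∀ σ ∈ C, ∀ τ ∈ C, σ * τ = τ * σ) (x : ι → K) :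
    ∃ p, ∀ g ∈ symmetryGroup, ∀ σ ∈ C, (∀ i, g (x i) = x (σ i)) → g p = p := by
  -- A symmetry whose fixed points are permuted by the others fixes a suitable `p`.
  have key : ∀ t ∈ symmetryGroup, t ≠ 1 →
      (∀ g ∈ symmetryGroup, ∀ σ ∈ C, (∀ i, g (x i) = x (σ i)) →
        ∀ c, t c = c → t (g⁻¹ c) = g⁻¹ c) →
      ∃ p, ∀ g ∈ symmetryGroup, ∀ σ ∈ C, (∀ i, g (x i) = x (σ i)) → g p = p := by
    intro t ht hne h
    obtain ⟨p, hp, huniq⟩ := exists_unique_fixed_in_orbit ht hne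
    refine ⟨p, fun g hg σ hσ hx => ?_⟩
    have := huniq _ (h g hg σ hσ hx p hp) (orbitIndex_apply (inv_mem hg) p)
    exact (Equiv.Perm.inv_eq_iff_eq.1 this).symm
  by_cases hN : ∃ t ∈ symmetryGroup, t ≠ 1 ∧ ∀ i, t (x i) = x i
  · obtain ⟨t, ht, hne, hfix⟩ := hN
    by_cases hx : ∃ i, ∀ j, orbitIndex (x j) = orbitIndex (x i) → x j = x i
    · obtain ⟨i, hi⟩ := hx
      refine ⟨x i, fun g hg σ _ hgx => ?_⟩
      rw [hgx]
      exact hi _ (by rw [← hgx, orbitIndex_apply hg])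
    · push Not at hx
      obtain ⟨i⟩ := ‹Nonempty ι›
      obtain ⟨j, hij, hji⟩ := hx i
      refine key t ht hne fun g hg σ hσ hgx c hc => ?_
      have hconj : ∀ i, (g * t * g⁻¹) (x i) = x i := fun i => by
        have : g⁻¹ (x i) = x (σ⁻¹ i) := by
          rw [Equiv.Perm.inv_eq_iff_eq, hgx, perm_apply_inv_apply]
        simp only [Equiv.Perm.mul_apply, this, hfix, hgx, perm_apply_inv_apply]
      have := fixed_of_fixed ht hne (mul_mem (mul_mem hg ht) (inv_mem hg))
        (by rwa [ne_eq, conj_eq_one_iff]) hij hji (hfix i) (hfix j) (hconj i) (hconj j) hc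
      rw [eq_comm, Equiv.Perm.inv_eq_iff_eq]
      exact this.symm
  · push Not at hN
    by_cases hH : ∃ t ∈ symmetryGroup, t ≠ 1 ∧ ∃ τ ∈ C, ∀ i, t (x i) = x (τ i)
    · obtain ⟨t, ht, hne, τ, hτ, htx⟩ := hH
      refine key t ht hne fun g hg σ hσ hgx c hc => ?_
      have hcomm : g * t = t * g := by
        by_contra hgt
        obtain ⟨i, hi⟩ := hN ((t * g)⁻¹ * (g * t))
          (mul_mem (inv_mem (mul_mem ht hg)) (mul_mem hg ht))
          (fun h => hgt (inv_mul_eq_one.1 h).symm)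
        refine hi ?_
        rw [Equiv.Perm.mul_apply, Equiv.Perm.inv_eq_iff_eq]
        simp only [Equiv.Perm.mul_apply, htx, hgx]
        exact congrArg x (DFunLike.congr_fun (hC σ hσ τ hτ) i)
      apply g.injective
      rw [perm_apply_inv_apply, ← Equiv.Perm.mul_apply, hcomm, Equiv.Perm.mul_apply,
        perm_apply_inv_apply, hc]
    · push Not at hH
      refine ⟨k0, fun g hg σ hσ hgx => ?_⟩
      by_cases h1 : g = 1
      · rw [h1, Equiv.Perm.one_apply]
      · obtain ⟨i, hi⟩ := hH g hg h1 σ hσ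
        exact absurd (hgx i) hi

/-- The action of pairs of permutations on tuples, by postcomposition and reindexing. -/
abbrev tupleAction (α ι : Type*) : MulAction (Equiv.Perm α × Equiv.Perm ι) (ι → α) where
  smul m x := m.1 ∘ x ∘ ⇑m.2⁻¹
  one_smul _ := rfl
  mul_smul m m' x := by
    change ⇑(m.1 * m'.1) ∘ x ∘ ⇑(m.2 * m'.2)⁻¹ = m.1 ∘ (m'.1 ∘ x ∘ ⇑m'.2⁻¹) ∘ ⇑m.2⁻¹
    rw [mul_inv_rev]
    rfl

end K

/-- For every `n ≥ 2`, the relational structure `K` has an `n`-ary cyclic polymorphism. -/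
theorem K_has_cyclic_polymorphisms_all_arities :
    ∀ n : ℕ, 2 ≤ n → ∃ f : (Fin n → K) → K,
      (∀ x : Fin n → K, f (x ∘ finRotate n) = f x) ∧
      (∀ x : Fin n → K, f (r ∘ x) = r (f x)) ∧
      (∀ x : Fin n → K, f (s ∘ x) = s (f x)) := by
  intro n hn
  have : Nonempty (Fin n) := ⟨⟨0, by omega⟩⟩
  let _ : MulAction (Equiv.Perm K × Equiv.Perm (Fin n)) (Fin n → K) := K.tupleAction K (Fin n)
  let _ : MulAction (Equiv.Perm K × Equiv.Perm (Fin n)) K :=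
    MulAction.compHom K (MonoidHom.fst (Equiv.Perm K) (Equiv.Perm (Fin n)))
  let C := Subgroup.zpowers (finRotate n)
  have hC : ∀ σ ∈ C, ∀ τ ∈ C, σ * τ = τ * σ := by
    rintro _ ⟨a, rfl⟩ _ ⟨b, rfl⟩
    exact (Commute.refl (finRotate n)).zpow_zpow a b
  obtain ⟨f, hf⟩ := exists_equivariant_map (M := K.symmetryGroup.prod C)
    (X := Fin n → K) (Y := K) (by
      intro x
      obtain ⟨p, hp⟩ := K.exists_common_fixed C hC x
      refine ⟨p, ?_⟩
      rintro ⟨⟨g, σ⟩, hg, hσ⟩ hm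
      refine hp g hg σ hσ fun i => ?_
      have h : g ∘ x ∘ ⇑σ⁻¹ = x := hm
      simpa using congrFun h (σ i))
  refine ⟨f, fun x => ?_, fun x => ?_, fun x => ?_⟩
  · exact hf ⟨(1, (finRotate n)⁻¹), one_mem _, C.inv_mem (Subgroup.mem_zpowers _)⟩ x
  · exact hf ⟨(K.rPerm, 1), Subgroup.subset_closure (Or.inl rfl), one_mem _⟩ x
  · exact hf ⟨(K.sPerm, 1), Subgroup.subset_closure (Or.inr rfl), one_mem _⟩ x
end

section
/- Let p be a prime number, α a type, and x : Fin p → α a function that is not injective and whose range has at least 5 and at most 10 elements. Then there exists a natural number k ≥ 1 such that the set N_k = {a : α | the number of indices i : Fin p with x(i) = a equals k} is nonempty and has at most 4 elements. -/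
/-- Let `p` be prime and `x : Fin p → α` be non-injective with range of size between
5 and 10. Then there is some `k ≥ 1` such that the set of elements appearing exactly
`k` times among `x 0, …, x (p-1)` is nonempty and has at most 4 elements. -/
theorem exists_multiplicity_class_small {p : ℕ} (hp : p.Prime)
    {α : Type*} [DecidableEq α] (x : Fin p → α)
    (hni : ¬ Function.Injective x)
    (h5 : 5 ≤ (Finset.univ.image x).card)
    (h10 : (Finset.univ.image x).card ≤ 10) :
    ∃ k : ℕ, 1 ≤ k ∧
      {a : α | (Finset.univ.filter fun i : Fin p => x i = a).card = k}.Nonempty ∧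
      {a : α | (Finset.univ.filter fun i : Fin p => x i = a).card = k}.ncard ≤ 4 := by
  by_contra! H
  set f : α → ℕ := fun a => (Finset.univ.filter fun i : Fin p => x i = a).card with hf
  set S := Finset.univ.image x with hS
  have hsum : ∑ a ∈ S, f a = p := by
    have h := Finset.card_eq_sum_card_image x (Finset.univ : Finset (Fin p))
    rw [Finset.card_univ, Fintype.card_fin] at h
    exact h.symm
  have hpos : ∀ a ∈ S, 1 ≤ f a := by
    intro a ha
    obtain ⟨i, -, rfl⟩ := Finset.mem_image.1 ha
    exact Finset.card_pos.2 ⟨i, by simp⟩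
  have hmem : ∀ a, 1 ≤ f a → a ∈ S := by
    intro a ha
    obtain ⟨i, hi⟩ := Finset.card_pos.1 ha
    exact Finset.mem_image.2 ⟨i, Finset.mem_univ _, (Finset.mem_filter.1 hi).2⟩
  have hclass : ∀ a ∈ S, 5 ≤ (S.filter fun b => f b = f a).card := by
    intro a ha
    have h := H (f a) (hpos a ha) ⟨a, rfl⟩
    have heq : {b : α | f b = f a} = ↑(S.filter fun b => f b = f a) := by
      ext b
      simp only [Set.mem_ofPred_eq, Finset.coe_filter]
      exact ⟨fun hb => ⟨hmem b (hb ▸ hpos a ha), hb⟩, fun hb => hb.2⟩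
    change 4 < {b : α | f b = f a}.ncard at h
    rw [heq, Set.ncard_coe_finset] at h
    exact h
  have hconst : ∀ k, ∀ T : Finset α, (∀ b ∈ T, f b = k) → ∑ b ∈ T, f b = T.card * k := by
    intro k T hT
    rw [Finset.sum_congr rfl hT, Finset.sum_const, smul_eq_mul]
  have hSp : S.card ≠ p := by
    intro h
    have hinj : Set.InjOn x (Finset.univ : Finset (Fin p)) :=
      Finset.card_image_iff.1 (by rw [Finset.card_univ, Fintype.card_fin]; exact h)
    exact hni fun i j hij => hinj (by simp) (by simp) hij
  obtain ⟨a, ha⟩ : S.Nonempty := Finset.card_pos.1 (by omega)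
  have hsplit := Finset.sum_filter_add_sum_filter_not S (fun b => f b = f a) f
  have hcard := Finset.card_filter_add_card_filter_not (s := S) (fun b => f b = f a)
  have hA := hclass a ha
  rw [hsum, hconst (f a) _ fun b hb => (Finset.mem_filter.1 hb).2] at hsplit
  rcases (S.filter fun b => ¬ f b = f a).eq_empty_or_nonempty with hB | ⟨b, hb⟩
  · rw [hB, Finset.card_empty, add_zero] at hcard
    rw [hB, Finset.sum_empty, add_zero, hcard] at hsplit
    rcases (Nat.dvd_prime hp).1 (Dvd.intro _ hsplit) with h | h
    · omega
    · exact hSp h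
  · obtain ⟨hbS, hba⟩ := Finset.mem_filter.1 hb
    have hC := hclass b hbS
    have hsub : (S.filter fun c => f c = f b) ⊆ S.filter fun c => ¬ f c = f a := by
      intro c hc
      rw [Finset.mem_filter] at hc ⊢
      exact ⟨hc.1, hc.2 ▸ hba⟩
    have hle := Finset.card_le_card hsub
    have hEq := Finset.eq_of_subset_of_card_le hsub (by omega)
    rw [← hEq, hconst (f b) _ fun c hc => (Finset.mem_filter.1 hc).2,
      show (S.filter fun c => f c = f b).card = 5 by omega,
      show (S.filter fun c => f c = f a).card = 5 by omega, ← mul_add] at hsplit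
    have h1 := hpos a ha
    have h2 := hpos b hbS
    rcases (Nat.dvd_prime hp).1 (Dvd.intro _ hsplit) with h | h <;> omega
end

section
/- Let A be a set, s₂ : A → A → A a commutative binary operation (s₂(x,y) = s₂(y,x) for all x,y), and c₃ : A → A → A → A a cyclic ternary operation (c₃(x,y,z) = c₃(y,z,x) for all x,y,z). Then the ternary operation s₃ defined by s₃(x,y,z) = s₂(c₃(x,y,z), c₃(y,x,z)) is symmetric: s₃(x,y,z) = s₃(x_{σ(1)}, x_{σ(2)}, x_{σ(3)}) for every permutation σ of the three arguments. -/
/-- If `s₂` is a commutative binary operation and `c₃` a cyclic ternary operation, then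
`s₃ (x, y, z) = s₂ (c₃ (x, y, z), c₃ (y, x, z))` is a symmetric ternary operation. -/
theorem s3_symmetric {A : Type*} (s₂ : A → A → A) (c₃ : A → A → A → A)
    (hs₂ : ∀ x y, s₂ x y = s₂ y x)
    (hc₃ : ∀ x y z, c₃ x y z = c₃ y z x) :
    ∀ (σ : Equiv.Perm (Fin 3)) (v : Fin 3 → A),
      s₂ (c₃ (v (σ 0)) (v (σ 1)) (v (σ 2))) (c₃ (v (σ 1)) (v (σ 0)) (v (σ 2))) =
      s₂ (c₃ (v 0) (v 1) (v 2)) (c₃ (v 1) (v 0) (v 2)) := by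
  intro σ v
  have h01 : σ 0 ≠ σ 1 := σ.injective.ne (by decide)
  have h02 : σ 0 ≠ σ 2 := σ.injective.ne (by decide)
  have h12 : σ 1 ≠ σ 2 := σ.injective.ne (by decide)
  generalize σ 0 = a, σ 1 = b, σ 2 = c at *
  have h_even := hc₃ (v 0) (v 1) (v 2)
  have h_even' := hc₃ (v 1) (v 2) (v 0)
  have h_odd := hc₃ (v 1) (v 0) (v 2)
  have h_odd' := hc₃ (v 0) (v 2) (v 1)
  have h_comm := hs₂ (c₃ (v 0) (v 1) (v 2)) (c₃ (v 1) (v 0) (v 2))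
  fin_cases a <;> fin_cases b <;> fin_cases c <;>
    first
      | contradiction
      | rfl
      | (simp only [Fin.zero_eta, Fin.mk_one, Fin.reduceFinMk]; grind)
end

section
/- Let A be a set, s₂ : A → A → A a commutative binary operation, and s₃ : A → A → A → A a symmetric ternary operation (invariant under every permutation of its three arguments). Define t(x,y,z,w) = s₂(s₂(x,y), s₂(z,w)) and s₄(x,y,z,w) = s₃(t(x,y,z,w), t(x,w,y,z), t(x,z,y,w)). Then s₄ is symmetric: its value is unchanged under every permutation of its four arguments. -/
/-- A function of tuples that is invariant under adjacent transpositions of the coordinates is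
invariant under every permutation of the coordinates. -/
theorem comp_perm_eq_of_comp_swap_eq {A B : Type*} {n : ℕ} (F : (Fin (n + 1) → A) → B)
    (hF : ∀ (i : Fin n) (v : Fin (n + 1) → A), F (v ∘ Equiv.swap i.castSucc i.succ) = F v)
    (σ : Equiv.Perm (Fin (n + 1))) (v : Fin (n + 1) → A) : F (v ∘ σ) = F v := by
  have hσ : σ ∈ Submonoid.closure
      (Set.range fun i : Fin n => Equiv.swap i.castSucc i.succ) := by
    rw [Equiv.Perm.mclosure_swap_castSucc_succ]
    trivial
  induction hσ using Submonoid.closure_induction generalizing v with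
  | mem τ hτ =>
    obtain ⟨i, rfl⟩ := hτ
    exact hF i v
  | one => rfl
  | mul τ ρ _ _ ihτ ihρ =>
    rw [Equiv.Perm.coe_mul, ← Function.comp_assoc, ihρ, ihτ]

/-- If `s₂` is a commutative binary operation and `s₃` a symmetric ternary operation,
then with `t (x, y, z, w) = s₂ (s₂ (x, y), s₂ (z, w))`, the operation
`s₄ (x, y, z, w) = s₃ (t (x, y, z, w), t (x, w, y, z), t (x, z, y, w))`
is a symmetric 4-ary operation. -/
theorem s4_symmetric {A : Type*} (s₂ : A → A → A) (s₃ : A → A → A → A)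
    (hs₂ : ∀ x y, s₂ x y = s₂ y x)
    (hs₃ : ∀ (σ : Equiv.Perm (Fin 3)) (v : Fin 3 → A),
      s₃ (v (σ 0)) (v (σ 1)) (v (σ 2)) = s₃ (v 0) (v 1) (v 2)) :
    ∀ (σ : Equiv.Perm (Fin 4)) (v : Fin 4 → A),
      (fun x y z w => s₃ (s₂ (s₂ x y) (s₂ z w)) (s₂ (s₂ x w) (s₂ y z))
        (s₂ (s₂ x z) (s₂ y w)))
        (v (σ 0)) (v (σ 1)) (v (σ 2)) (v (σ 3)) =
      (fun x y z w => s₃ (s₂ (s₂ x y) (s₂ z w)) (s₂ (s₂ x w) (s₂ y z))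
        (s₂ (s₂ x z) (s₂ y w)))
        (v 0) (v 1) (v 2) (v 3) := by
  have h_right : ∀ a b c, s₃ a b c = s₃ a c b := fun a b c =>
    hs₃ (Equiv.swap 1 2) ![a, c, b]
  have h_outer : ∀ a b c, s₃ a b c = s₃ c b a := fun a b c =>
    hs₃ (Equiv.swap 0 2) ![c, b, a]
  refine comp_perm_eq_of_comp_swap_eq (fun v : Fin 4 → A =>
    s₃ (s₂ (s₂ (v 0) (v 1)) (s₂ (v 2) (v 3))) (s₂ (s₂ (v 0) (v 3)) (s₂ (v 1) (v 2)))
      (s₂ (s₂ (v 0) (v 2)) (s₂ (v 1) (v 3)))) fun i v => ?_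
  fin_cases i
  · change s₃ (s₂ (s₂ (v 1) (v 0)) (s₂ (v 2) (v 3))) (s₂ (s₂ (v 1) (v 3)) (s₂ (v 0) (v 2)))
      (s₂ (s₂ (v 1) (v 2)) (s₂ (v 0) (v 3))) = _
    rw [h_right, hs₂ (v 1) (v 0), hs₂ (s₂ (v 1) (v 2)), hs₂ (s₂ (v 1) (v 3))]
  · change s₃ (s₂ (s₂ (v 0) (v 2)) (s₂ (v 1) (v 3))) (s₂ (s₂ (v 0) (v 3)) (s₂ (v 2) (v 1)))
      (s₂ (s₂ (v 0) (v 1)) (s₂ (v 2) (v 3))) = _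
    rw [h_outer, hs₂ (v 2) (v 1)]
  · change s₃ (s₂ (s₂ (v 0) (v 1)) (s₂ (v 3) (v 2))) (s₂ (s₂ (v 0) (v 2)) (s₂ (v 1) (v 3)))
      (s₂ (s₂ (v 0) (v 3)) (s₂ (v 1) (v 2))) = _
    rw [h_right, hs₂ (v 3) (v 2)]
end

section
/- Let B be a set equipped with a family of relations: an index type ι, arities m : ι → ℕ, and relations Rᵢ ⊆ (Fin (m i) → B) for each i : ι. If this relational structure has a 2-ary cyclic polymorphism (equivalently, a commutative binary polymorphism) and a 3-ary cyclic polymorphism, then it has symmetric polymorphisms of arities 2, 3 and 4. -/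
/-- `IsPolymorphism m R n f` says that `f` is an `n`-ary polymorphism of the relational
structure on `B` whose relations are `R i ⊆ (Fin (m i) → B)` for `i : ι`. -/
def IsPolymorphism {B : Type*} {ι : Type*} (m : ι → ℕ)
    (R : ∀ i : ι, Set (Fin (m i) → B)) (n : ℕ) (f : (Fin n → B) → B) : Prop :=
  ∀ (i : ι) (x : Fin n → Fin (m i) → B), (∀ k, x k ∈ R i) →
    (fun j => f fun k => x k j) ∈ R i

/-- An `n`-ary operation is cyclic if it is invariant under the cyclic shift of its
arguments. -/
def IsCyclicOp {B : Type*} (n : ℕ) (f : (Fin n → B) → B) : Prop :=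
  ∀ x : Fin n → B, f (x ∘ finRotate n) = f x

/-- An `n`-ary operation is symmetric if it is invariant under every permutation of its
arguments. -/
def IsSymmetricOp {B : Type*} (n : ℕ) (f : (Fin n → B) → B) : Prop :=
  ∀ (x : Fin n → B) (σ : Equiv.Perm (Fin n)), f (x ∘ σ) = f x

theorem IsPolymorphism.proj {B : Type*} {ι : Type*} {m : ι → ℕ}
    {R : ∀ i : ι, Set (Fin (m i) → B)} {n : ℕ} (k : Fin n) :
    IsPolymorphism m R n fun x => x k :=
  fun _ _ hx => hx k

theorem IsPolymorphism.comp {B : Type*} {ι : Type*} {m : ι → ℕ}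
    {R : ∀ i : ι, Set (Fin (m i) → B)} {n k : ℕ} {f : (Fin k → B) → B}
    {g : Fin k → (Fin n → B) → B} (hf : IsPolymorphism m R k f)
    (hg : ∀ l, IsPolymorphism m R n (g l)) :
    IsPolymorphism m R n fun x => f fun l => g l x :=
  fun i x hx => hf i (fun l j => g l fun k => x k j) fun l => hg l i x hx

theorem IsPolymorphism.comp₂ {B : Type*} {ι : Type*} {m : ι → ℕ}
    {R : ∀ i : ι, Set (Fin (m i) → B)} {n : ℕ} {f : (Fin 2 → B) → B}
    {g h : (Fin n → B) → B} (hf : IsPolymorphism m R 2 f)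
    (hg : IsPolymorphism m R n g) (hh : IsPolymorphism m R n h) :
    IsPolymorphism m R n fun x => f ![g x, h x] := by
  convert hf.comp (g := ![g, h]) (by simp [Fin.forall_fin_two, hg, hh]) using 3 with x
  ext l
  fin_cases l <;> rfl

theorem IsPolymorphism.comp₃ {B : Type*} {ι : Type*} {m : ι → ℕ}
    {R : ∀ i : ι, Set (Fin (m i) → B)} {n : ℕ} {f : (Fin 3 → B) → B}
    {g h k : (Fin n → B) → B} (hf : IsPolymorphism m R 3 f)
    (hg : IsPolymorphism m R n g) (hh : IsPolymorphism m R n h) (hk : IsPolymorphism m R n k) :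
    IsPolymorphism m R n fun x => f ![g x, h x, k x] := by
  convert hf.comp (g := ![g, h, k])
    (by simp [Fin.forall_fin_succ, hg, hh, hk]) using 3 with x
  ext l
  fin_cases l <;> rfl

/-- Symmetry of an operation can be checked on adjacent transpositions. -/
theorem isSymmetricOp_of_swap {B : Type*} {n : ℕ} {f : (Fin (n + 1) → B) → B}
    (h : ∀ (i : Fin n) (x : Fin (n + 1) → B), f (x ∘ Equiv.swap i.castSucc i.succ) = f x) :
    IsSymmetricOp (n + 1) f := by
  intro x σ
  have hσ : σ ∈ Submonoid.closure
      (Set.range fun i : Fin n => Equiv.swap i.castSucc i.succ) := by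
    rw [Equiv.Perm.mclosure_swap_castSucc_succ]
    trivial
  induction hσ using Submonoid.closure_induction generalizing x with
  | mem τ hτ =>
    obtain ⟨i, rfl⟩ := hτ
    exact h i x
  | one => rfl
  | mul τ ρ _ _ hτ hρ =>
    rw [Equiv.Perm.coe_mul, ← Function.comp_assoc, hρ, hτ]

theorem IsCyclicOp.comm {B : Type*} {f : (Fin 2 → B) → B} (hf : IsCyclicOp 2 f) (a b : B) :
    f ![a, b] = f ![b, a] := by
  rw [← hf ![b, a]]
  congr 1
  ext l
  fin_cases l <;> rfl

theorem IsCyclicOp.rotate {B : Type*} {f : (Fin 3 → B) → B} (hf : IsCyclicOp 3 f) (a b c : B) :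
    f ![a, b, c] = f ![b, c, a] := by
  rw [← hf ![a, b, c]]
  congr 1
  ext l
  fin_cases l <;> rfl

theorem IsCyclicOp.isSymmetricOp {B : Type*} {f : (Fin 2 → B) → B} (hf : IsCyclicOp 2 f) :
    IsSymmetricOp 2 f := by
  refine isSymmetricOp_of_swap fun i x => ?_
  rw [← hf x]
  congr 1
  ext l
  fin_cases i
  fin_cases l <;> rfl

/-- The symmetrization of a ternary cyclic operation by a binary commutative one. -/
def symmetrize₃ {B : Type*} (f : (Fin 2 → B) → B) (g : (Fin 3 → B) → B) (x : Fin 3 → B) : B :=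
  f ![g ![x 0, x 1, x 2], g ![x 1, x 0, x 2]]

/-- The composite of a ternary symmetric operation with a binary commutative one, ranging over the
three partitions of the four arguments into two pairs. -/
def symmetrize₄ {B : Type*} (f : (Fin 2 → B) → B) (s : (Fin 3 → B) → B) (x : Fin 4 → B) : B :=
  s ![f ![f ![x 0, x 1], f ![x 2, x 3]], f ![f ![x 0, x 2], f ![x 1, x 3]],
    f ![f ![x 0, x 3], f ![x 1, x 2]]]

theorem isSymmetricOp_symmetrize₃ {B : Type*} {f : (Fin 2 → B) → B} {g : (Fin 3 → B) → B}
    (hf : IsCyclicOp 2 f) (hg : IsCyclicOp 3 g) : IsSymmetricOp 3 (symmetrize₃ f g) := by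
  refine isSymmetricOp_of_swap fun i x => ?_
  fin_cases i
  · exact hf.comm _ _
  · change f ![g ![x 0, x 2, x 1], g ![x 2, x 0, x 1]] = f ![g ![x 0, x 1, x 2], g ![x 1, x 0, x 2]]
    rw [hf.comm, hg.rotate (x 2), hg.rotate (x 0) (x 2), hg.rotate (x 2), ← hg.rotate (x 2) (x 1)]

theorem isSymmetricOp_symmetrize₄ {B : Type*} {f : (Fin 2 → B) → B} {s : (Fin 3 → B) → B}
    (hf : IsCyclicOp 2 f) (hs : IsSymmetricOp 3 s) : IsSymmetricOp 4 (symmetrize₄ f s) := by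
  have swap_left (a b c : B) : s ![b, a, c] = s ![a, b, c] := by
    rw [← hs ![a, b, c] (Equiv.swap 0 1)]
    congr 1
    ext l
    fin_cases l <;> rfl
  have swap_right (a b c : B) : s ![a, c, b] = s ![a, b, c] := by
    rw [← hs ![a, b, c] (Equiv.swap 1 2)]
    congr 1
    ext l
    fin_cases l <;> rfl
  refine isSymmetricOp_of_swap fun i x => ?_
  fin_cases i
  · change s ![f ![f ![x 1, x 0], f ![x 2, x 3]], f ![f ![x 1, x 2], f ![x 0, x 3]],
      f ![f ![x 1, x 3], f ![x 0, x 2]]] = _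
    rw [swap_right, hf.comm (x 1) (x 0), hf.comm (f ![x 1, x 3]), hf.comm (f ![x 1, x 2])]
    rfl
  · change s ![f ![f ![x 0, x 2], f ![x 1, x 3]], f ![f ![x 0, x 1], f ![x 2, x 3]],
      f ![f ![x 0, x 3], f ![x 2, x 1]]] = _
    rw [swap_left, hf.comm (x 2) (x 1)]
    rfl
  · change s ![f ![f ![x 0, x 1], f ![x 3, x 2]], f ![f ![x 0, x 3], f ![x 1, x 2]],
      f ![f ![x 0, x 2], f ![x 1, x 3]]] = _
    rw [swap_right, hf.comm (x 3) (x 2)]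
    rfl

theorem IsPolymorphism.symmetrize₃ {B : Type*} {ι : Type*} {m : ι → ℕ}
    {R : ∀ i : ι, Set (Fin (m i) → B)} {f : (Fin 2 → B) → B} {g : (Fin 3 → B) → B}
    (hf : IsPolymorphism m R 2 f) (hg : IsPolymorphism m R 3 g) :
    IsPolymorphism m R 3 (symmetrize₃ f g) :=
  hf.comp₂ (hg.comp₃ (.proj 0) (.proj 1) (.proj 2)) (hg.comp₃ (.proj 1) (.proj 0) (.proj 2))

theorem IsPolymorphism.symmetrize₄ {B : Type*} {ι : Type*} {m : ι → ℕ}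
    {R : ∀ i : ι, Set (Fin (m i) → B)} {f : (Fin 2 → B) → B} {s : (Fin 3 → B) → B}
    (hf : IsPolymorphism m R 2 f) (hs : IsPolymorphism m R 3 s) :
    IsPolymorphism m R 4 (symmetrize₄ f s) :=
  hs.comp₃ (hf.comp₂ (hf.comp₂ (.proj 0) (.proj 1)) (hf.comp₂ (.proj 2) (.proj 3)))
    (hf.comp₂ (hf.comp₂ (.proj 0) (.proj 2)) (hf.comp₂ (.proj 1) (.proj 3)))
    (hf.comp₂ (hf.comp₂ (.proj 0) (.proj 3)) (hf.comp₂ (.proj 1) (.proj 2)))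

/-- If a relational structure has a binary cyclic (i.e. commutative) polymorphism and a
ternary cyclic polymorphism, then it has symmetric polymorphisms of arities 2, 3 and 4. -/
theorem symmetric_upto_4_of_cyclic_2_3 {B : Type*} {ι : Type*} (m : ι → ℕ)
    (R : ∀ i : ι, Set (Fin (m i) → B))
    (h2 : ∃ f : (Fin 2 → B) → B, IsPolymorphism m R 2 f ∧ IsCyclicOp 2 f)
    (h3 : ∃ f : (Fin 3 → B) → B, IsPolymorphism m R 3 f ∧ IsCyclicOp 3 f) :
    (∃ f : (Fin 2 → B) → B, IsPolymorphism m R 2 f ∧ IsSymmetricOp 2 f) ∧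
    (∃ f : (Fin 3 → B) → B, IsPolymorphism m R 3 f ∧ IsSymmetricOp 3 f) ∧
    (∃ f : (Fin 4 → B) → B, IsPolymorphism m R 4 f ∧ IsSymmetricOp 4 f) := by
  obtain ⟨f, hf, hfc⟩ := h2
  obtain ⟨g, hg, hgc⟩ := h3
  have hs := isSymmetricOp_symmetrize₃ hfc hgc
  exact ⟨⟨f, hf, hfc.isSymmetricOp⟩, ⟨_, hf.symmetrize₃ hg, hs⟩,
    ⟨_, hf.symmetrize₄ (hf.symmetrize₃ hg), isSymmetricOp_symmetrize₄ hfc hs⟩⟩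
end

section
/- Let B be a set equipped with a family of relations: an index type ι, arities m : ι → ℕ, and relations Rᵢ ⊆ (Fin (m i) → B) for each i : ι. If this relational structure has an n-ary cyclic polymorphism and k > 1 divides n, then it has a k-ary cyclic polymorphism. -/
/-- Reduction modulo a divisor `k` of `n` commutes with the cyclic shift. -/
theorem finRotate_ofNat_of_dvd {n k : ℕ} [NeZero k] (hdvd : k ∣ n) (i : Fin n) :
    finRotate k (Fin.ofNat k i) = Fin.ofNat k (finRotate n i) := by
  obtain _ | n := n
  · exact i.elim0
  rw [finRotate_apply, finRotate_apply]
  ext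
  simp only [Fin.val_add, Fin.val_ofNat, Fin.val_one', Nat.mod_mod_of_dvd _ hdvd]
  rw [← Nat.add_mod, Nat.add_mod i.val (1 % (n + 1)) k, Nat.mod_mod_of_dvd _ hdvd,
    ← Nat.add_mod]

/-- If a relational structure has an `n`-ary cyclic polymorphism and `k > 1` divides `n`,
then it has a `k`-ary cyclic polymorphism. -/
theorem cyclic_polymorphism_of_dvd {B : Type*} {ι : Type*} (m : ι → ℕ)
    (R : ∀ i : ι, Set (Fin (m i) → B)) {n k : ℕ}
    (hk : 1 < k) (hdvd : k ∣ n)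
    (hn : ∃ f : (Fin n → B) → B, IsPolymorphism m R n f ∧ IsCyclicOp n f) :
    ∃ f : (Fin k → B) → B, IsPolymorphism m R k f ∧ IsCyclicOp k f := by
  have : NeZero k := ⟨by omega⟩
  obtain ⟨f, hf, hcyc⟩ := hn
  refine ⟨fun y => f fun i => y (Fin.ofNat k i),
    fun i x hx => hf i (fun l => x (Fin.ofNat k l)) fun l => hx _, fun y => ?_⟩
  have h := hcyc fun i => y (Fin.ofNat k i)
  simpa only [Function.comp_def, finRotate_ofNat_of_dvd hdvd] using h
end

section
/- Let B be a set equipped with a family of relations: an index type ι, arities m : ι → ℕ, and relations Rᵢ ⊆ (Fin (m i) → B) for each i : ι. If this relational structure has an n-ary cyclic polymorphism and an m-ary cyclic polymorphism (n, m ≥ 1), then it has an (n·m)-ary cyclic polymorphism. -/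
theorem val_finRotate_eq_mod {n : ℕ} (i : Fin n) :
    (finRotate n i : ℕ) = (i + 1) % n := by
  cases n with
  | zero => exact i.elim0
  | succ n => rw [finRotate_apply, Fin.val_add, Fin.val_one', Nat.add_mod_mod]

/-- The index `i + n * j` of the `j`-th element in the residue class of `i` modulo `n`. -/
def residueIndex {n m : ℕ} (i : Fin n) (j : Fin m) : Fin (n * m) :=
  ⟨i + n * j, by
    calc (i : ℕ) + n * j < n + n * j := by have := i.isLt; omega
      _ = n * (j + 1) := by ring
      _ ≤ n * m := Nat.mul_le_mul_left n j.isLt⟩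

theorem finRotate_residueIndex_of_lt {n m : ℕ} (i : Fin n) (j : Fin m) (h : (i : ℕ) + 1 < n) :
    finRotate (n * m) (residueIndex i j) = residueIndex (finRotate n i) j := by
  have hi : (finRotate n i : ℕ) = i + 1 := by
    rw [val_finRotate_eq_mod, Nat.mod_eq_of_lt h]
  have hlt := (residueIndex (finRotate n i) j).isLt
  ext
  rw [val_finRotate_eq_mod]
  simp only [residueIndex, hi] at hlt ⊢
  rw [add_right_comm, Nat.mod_eq_of_lt hlt]

theorem finRotate_residueIndex_of_eq {n m : ℕ} (i : Fin n) (j : Fin m) (h : (i : ℕ) + 1 = n) :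
    finRotate (n * m) (residueIndex i j) = residueIndex (finRotate n i) (finRotate m j) := by
  have hi : (finRotate n i : ℕ) = 0 := by
    rw [val_finRotate_eq_mod, h, Nat.mod_self]
  ext
  rw [val_finRotate_eq_mod]
  simp only [residueIndex, hi, val_finRotate_eq_mod j]
  rw [add_right_comm, h, zero_add, ← Nat.mul_mod_mul_left]
  congr 1
  ring

/-- Apply `g` on each residue class modulo `n`, then `f` to the results. -/
def residueComp {B : Type*} {n m : ℕ} (f : (Fin n → B) → B) (g : (Fin m → B) → B)
    (x : Fin (n * m) → B) : B :=
  f fun i => g fun j => x (residueIndex i j)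

theorem IsPolymorphism.residueComp {B : Type*} {ι : Type*} {ar : ι → ℕ}
    {R : ∀ i : ι, Set (Fin (ar i) → B)} {n m : ℕ} {f : (Fin n → B) → B} {g : (Fin m → B) → B}
    (hf : IsPolymorphism ar R n f) (hg : IsPolymorphism ar R m g) :
    IsPolymorphism ar R (n * m) (residueComp f g) := fun i x hx =>
  hf i (fun k l => g fun j => x (residueIndex k j) l) fun k =>
    hg i (fun j => x (residueIndex k j)) fun _ => hx _

theorem IsCyclicOp.residueComp {B : Type*} {n m : ℕ} {f : (Fin n → B) → B}
    {g : (Fin m → B) → B} (hf : IsCyclicOp n f) (hg : IsCyclicOp m g) :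
    IsCyclicOp (n * m) (residueComp f g) := by
  intro x
  refine Eq.trans (congrArg f (funext fun i => ?_))
    (hf fun i => g fun j => x (residueIndex i j))
  rcases (Nat.succ_le_of_lt i.isLt).lt_or_eq with h | h
  · simp only [Function.comp_apply, finRotate_residueIndex_of_lt i _ h]
  · simp only [Function.comp_apply, finRotate_residueIndex_of_eq i _ h]
    exact hg fun j => x (residueIndex (finRotate n i) j)

/-- If a relational structure has an `n`-ary cyclic polymorphism and an `m`-ary cyclic
polymorphism, then it has an `n·m`-ary cyclic polymorphism. -/
theorem cyclic_polymorphism_mul {B : Type*} {ι : Type*} (ar : ι → ℕ)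
    (R : ∀ i : ι, Set (Fin (ar i) → B)) {n m : ℕ}
    (hn1 : 1 ≤ n) (hm1 : 1 ≤ m)
    (hn : ∃ f : (Fin n → B) → B, IsPolymorphism ar R n f ∧ IsCyclicOp n f)
    (hm : ∃ f : (Fin m → B) → B, IsPolymorphism ar R m f ∧ IsCyclicOp m f) :
    ∃ f : (Fin (n * m) → B) → B, IsPolymorphism ar R (n * m) f ∧ IsCyclicOp (n * m) f := by
  obtain ⟨f, hf, hfc⟩ := hn
  obtain ⟨g, hg, hgc⟩ := hm
  exact ⟨residueComp f g, hf.residueComp hg, hfc.residueComp hgc⟩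
end

section
/- Let B be a finite set with N elements, equipped with a family of relations: an index type ι, arities m : ι → ℕ, and relations Rᵢ ⊆ (Fin (m i) → B) for each i : ι. Then the following are equivalent: (1) the structure has an n-ary cyclic polymorphism for some n ≥ 2; (2) for every prime p > N, the structure has a p-ary cyclic polymorphism. -/
section Operations

variable {W : Type} {A Y Z : Type*}

/-- `S` is preserved by the pair of operations `f`, `g` applied row by row. -/
def Compat (f : (W → Y) → Y) (g : (W → Z) → Z) (S : Y → Z → Prop) : Prop :=
  ∀ x y, (∀ w, S (x w) (y w)) → S (f x) (g y)

/-- `C` is preserved by the operation `f`. -/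
def ClosedUnder (f : (W → Y) → Y) (C : Set Y) : Prop :=
  ∀ x, (∀ w, x w ∈ C) → f x ∈ C

/-- Applying `f` to arguments in `C`, except for a single argument in `X`, gives a value in `C`. -/
def OpAbsorbs (f : (W → Y) → Y) (X C : Set Y) : Prop :=
  ∀ x w₀, x w₀ ∈ X → (∀ w, w ≠ w₀ → x w ∈ C) → f x ∈ C

/-- The coordinatewise extension of an operation to a power. -/
def piOp {I : Type*} (f : (W → Y) → Y) : (W → (I → Y)) → (I → Y) :=
  fun x i => f (fun w => x w i)

/-- Every value can be attained while any single argument is prescribed. -/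
def FreeArgs (f : (W → Y) → Y) : Prop :=
  ∀ w₀ a b, ∃ x, x w₀ = a ∧ f x = b

/-- Every congruence of `f` is either equality or the full relation. -/
def SimpleOp (f : (W → Y) → Y) : Prop :=
  ∀ E : Y → Y → Prop, Equivalence E → Compat f f E →
    (∀ a b, E a b → a = b) ∨ ∀ a b, E a b

/-- No nonempty proper set absorbs the whole algebra. -/
def AbsorptionFree (f : (W → Y) → Y) : Prop :=
  ∀ C : Set Y, C.Nonempty → OpAbsorbs f Set.univ C → C = Set.univ

theorem Compat.comp {V : Type*} {f : (W → Y) → Y} {g : (W → Z) → Z} {h : (W → V) → V}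
    {S : Y → Z → Prop} {T : Z → V → Prop} (hS : Compat f g S) (hT : Compat g h T) :
    Compat f h (fun a c => ∃ b, S a b ∧ T b c) := by
  intro x y hxy
  choose z hz hz' using hxy
  exact ⟨g z, hS x z hz, hT z y hz'⟩

theorem Compat.swap {f : (W → Y) → Y} {g : (W → Z) → Z} {S : Y → Z → Prop}
    (hS : Compat f g S) : Compat g f (fun b a => S a b) :=
  fun x y hxy => hS y x hxy

/-- A reflexive symmetric compatible relation that is not transitive is properly contained in
its square. -/
theorem lt_sq_of_not_transitive {E : A → A → Prop} (hrefl : ∀ a, E a a)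
    (htr : ¬ ∀ a b c, E a b → E b c → E a c) : E < fun a b => ∃ c, E a c ∧ E c b := by
  refine lt_of_le_not_ge (fun a b h => ⟨b, h, hrefl b⟩) fun hle => htr fun a b c h₁ h₂ => ?_
  exact hle a c ⟨b, h₁, h₂⟩

theorem SimpleOp.exists_boundary [Finite A] {f : (W → A) → A} (hf : SimpleOp f)
    {S : Set A} (hS : S.Nonempty) (hS' : S ≠ Set.univ) (E : A → A → Prop) :
    (∀ a, E a a) → (∀ a b, E a b → E b a) → Compat f f E → (¬ ∀ a b, E a b → a = b) →
    ∃ a ∈ S, ∃ b, b ∉ S ∧ E a b := by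
  induction E using WellFoundedGT.induction with
  | ind E ih =>
  intro hrefl hsymm hE hne
  by_cases htr : ∀ a b c, E a b → E b c → E a c
  · rcases hf E ⟨hrefl, fun h => hsymm _ _ h, fun h h' => htr _ _ _ h h'⟩ hE with h | h
    · exact absurd h hne
    · obtain ⟨a, ha⟩ := hS
      obtain ⟨b, hb⟩ := (Set.ne_univ_iff_exists_notMem S).1 hS'
      exact ⟨a, ha, b, hb, h a b⟩
  · obtain ⟨a, ha, b, hb, c, hac, hcb⟩ := ih _ (lt_sq_of_not_transitive hrefl htr)
      (fun a => ⟨a, hrefl a, hrefl a⟩)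
      (fun a b ⟨c, h, h'⟩ => ⟨c, hsymm _ _ h', hsymm _ _ h⟩) (hE.comp hE)
      (fun h => hne fun a b hab => h a b ⟨b, hab, hrefl b⟩)
    by_cases hc : c ∈ S
    · exact ⟨c, hc, b, hb, hcb⟩
    · exact ⟨a, ha, c, hc, hac⟩

theorem FreeArgs.absorbs_center {f : (W → A) → A} (hf : FreeArgs f) {g : (W → Y) → Y}
    {S : Y → A → Prop} (hS : Compat g f S) {X : Set Y} (hX : ∀ x ∈ X, ∃ a, S x a) :
    OpAbsorbs g X {x | ∀ a, S x a} := by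
  intro x w₀ hx hC b
  obtain ⟨a, ha⟩ := hX _ hx
  obtain ⟨y, hy, rfl⟩ := hf w₀ a b
  refine hS x y fun w => ?_
  by_cases hw : w = w₀
  · subst hw; rwa [hy]
  · exact hC w hw _

theorem exists_center [Finite A] [Nonempty A] {f : (W → A) → A}
    (hidem : ∀ a, f (fun _ => a) = a) (hfree : FreeArgs f) (haf : AbsorptionFree f)
    {g : (W → Y) → Y} {S : Y → A → Prop} (hS : Compat g f S)
    (hpair : ∀ a b, ∃ x, S x a ∧ S x b) : ∃ x, ∀ a, S x a := by
  classical
  cases nonempty_fintype A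
  by_contra hno
  let bad : ℕ → Prop := fun n => ∃ U : Finset A, U.card = n ∧ ∀ x, ¬ ∀ a ∈ U, S x a
  have hbad : ∃ n, bad n := ⟨_, Finset.univ, rfl, fun x h => hno ⟨x, fun a => h a (by simp)⟩⟩
  obtain ⟨U, hU, hUbad⟩ := Nat.find_spec hbad
  have good : ∀ V : Finset A, V.card < U.card → ∃ x, ∀ a ∈ V, S x a := by
    intro V hV
    by_contra hn
    exact Nat.find_min hbad (hU ▸ hV) ⟨V, rfl, fun x hx => hn ⟨x, hx⟩⟩
  have hcard : 2 < U.card := by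
    by_contra hle
    have hle : U.card ≤ 2 := by omega
    obtain ⟨a₀⟩ := ‹Nonempty A›
    have : ∃ a b, U ⊆ {a, b} := by
      interval_cases h : U.card
      · exact ⟨a₀, a₀, by simp [Finset.card_eq_zero.1 h]⟩
      · obtain ⟨a, rfl⟩ := Finset.card_eq_one.1 h
        exact ⟨a, a, by simp⟩
      · obtain ⟨a, b, -, rfl⟩ := Finset.card_eq_two.1 h
        exact ⟨a, b, by simp⟩
    obtain ⟨a, b, hab⟩ := this
    obtain ⟨x, hxa, hxb⟩ := hpair a b
    refine hUbad x fun c hc => ?_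
    rcases Finset.mem_insert.1 (hab hc) with rfl | hc
    · exact hxa
    · rw [Finset.mem_singleton.1 hc]; exact hxb
  obtain ⟨u, v, c, hu, hv, hc, huv, huc, hvc⟩ := Finset.two_lt_card_iff.1 hcard
  let U' := (U.erase u).erase v
  have hU' : U'.card + 2 = U.card := by
    have h₁ := Finset.card_erase_add_one hu
    have h₂ := Finset.card_erase_add_one (Finset.mem_erase.2 ⟨huv.symm, hv⟩)
    rw [← h₁, ← h₂]
  have hcU' : c ∈ U' := by simp [U', hc, huc.symm, hvc.symm]
  let F : A → A → Prop := fun a b => ∃ x, (∀ t ∈ U', S x t) ∧ S x a ∧ S x b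
  have hgood : ∀ b, ∃ x, (∀ t ∈ U', S x t) ∧ S x b := by
    intro b
    obtain ⟨x, hx⟩ := good (insert b U') (by have := Finset.card_insert_le b U'; omega)
    exact ⟨x, fun t ht => hx t (Finset.mem_insert_of_mem ht), hx b (Finset.mem_insert_self _ _)⟩
  have hF : Compat f f F := by
    intro x y hxy
    choose z hz hzx hzy using hxy
    refine ⟨g z, fun t ht => ?_, hS _ _ hzx, hS _ _ hzy⟩
    rw [← hidem t]
    exact hS _ _ fun w => hz w t ht
  have hcen := haf {a | ∀ b, F a b} ⟨c, fun b => (hgood b).imp fun x hx => ⟨hx.1, hx.1 c hcU', hx.2⟩⟩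
    (hfree.absorbs_center hF fun a _ => ⟨a, (hgood a).imp fun x hx => ⟨hx.1, hx.2, hx.2⟩⟩)
  have hFuv : F u v := (hcen ▸ Set.mem_univ u : u ∈ {a | ∀ b, F a b}) v
  obtain ⟨x, hx, hxu, hxv⟩ := hFuv
  refine hUbad x fun a ha => ?_
  by_cases hau : a = u
  · exact hau ▸ hxu
  by_cases hav : a = v
  · exact hav ▸ hxv
  · exact hx a (by simp [U', ha, hau, hav])

theorem linked_full [Finite A] [Nonempty A] {f : (W → A) → A}
    (hidem : ∀ a, f (fun _ => a) = a) (hfree : FreeArgs f) (haf : AbsorptionFree f)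
    (hf : SimpleOp f) (E : A → A → Prop) :
    (∀ a, E a a) → (∀ a b, E a b → E b a) → Compat f f E → (¬ ∀ a b, E a b → a = b) →
    ∀ a b, E a b := by
  induction E using WellFoundedGT.induction with
  | ind E ih =>
  intro hrefl hsymm hE hne
  by_cases htr : ∀ a b c, E a b → E b c → E a c
  · rcases hf E ⟨hrefl, fun h => hsymm _ _ h, fun h h' => htr _ _ _ h h'⟩ hE with h | h
    · exact absurd h hne
    · exact h
  · have hsq := ih _ (lt_sq_of_not_transitive hrefl htr)
      (fun a => ⟨a, hrefl a, hrefl a⟩)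
      (fun a b ⟨c, h, h'⟩ => ⟨c, hsymm _ _ h', hsymm _ _ h⟩) (hE.comp hE)
      (fun h => hne fun a b hab => h a b ⟨b, hab, hrefl b⟩)
    obtain ⟨x, hx⟩ := exists_center hidem hfree haf hE
      fun a b => (hsq a b).imp fun c hc => ⟨hsymm _ _ hc.1, hc.2⟩
    have hcen := haf {a | ∀ b, E a b} ⟨x, hx⟩
      (hfree.absorbs_center hE fun a _ => ⟨a, hrefl a⟩)
    exact fun a b => (hcen ▸ Set.mem_univ a : a ∈ {a | ∀ b, E a b}) b

end Operations

section CyclicRelations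

variable {W : Type} {A : Type*} {p : ℕ}

theorem end_pow_eq_iterate {α : Type*} (g : Function.End α) (n : ℕ) : g ^ n = g^[n] :=
  hom_coe_pow (fun g : Function.End α => g) rfl (fun _ _ => rfl) g n

/-- A shift-invariant relation without constant tuples on a simple idempotent algebra, minimal in
the sense that none of its tuples lies in a proper subalgebra. -/
structure IsCritical (f : (W → A) → A) (R : Set (ZMod p → A)) : Prop where
  idem : ∀ a, f (fun _ => a) = a
  closed : ClosedUnder (piOp f) R
  shift : ∀ r ∈ R, ∀ s, (fun i => r (i + s)) ∈ R
  nonempty : R.Nonempty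
  no_const : ∀ a, (fun _ => a) ∉ R
  sub : ∀ C : Set A, ClosedUnder f C → ∀ r ∈ R, (∀ i, r i ∈ C) → C = Set.univ
  simple : SimpleOp f

/-- The pairs of entries at distance `d` in the tuples of `R`. -/
def StepRel (R : Set (ZMod p → A)) (d : ZMod p) (a b : A) : Prop :=
  ∃ r ∈ R, r 0 = a ∧ r d = b

namespace IsCritical

variable {f : (W → A) → A} {R : Set (ZMod p → A)}

theorem nonempty_carrier (h : IsCritical f R) : Nonempty A :=
  h.nonempty.elim fun r _ => ⟨r 0⟩

theorem proj_surjective (h : IsCritical f R) (i : ZMod p) (a : A) : ∃ r ∈ R, r i = a := by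
  obtain ⟨r₀, hr₀⟩ := h.nonempty
  have : {a | ∃ r ∈ R, r i = a} = Set.univ := by
    refine h.sub _ ?_ r₀ hr₀ fun j => ⟨_, h.shift r₀ hr₀ (j - i), by simp⟩
    intro x hx
    choose r hr hri using hx
    exact ⟨piOp f r, h.closed r hr, congrArg f (funext hri)⟩
  exact (this ▸ Set.mem_univ a : a ∈ {a | ∃ r ∈ R, r i = a})

theorem stepRel_apply (h : IsCritical f R) {r : ZMod p → A} (hr : r ∈ R) (i d : ZMod p) :
    StepRel R d (r i) (r (i + d)) :=
  ⟨_, h.shift r hr i, by simp, by simp [add_comm]⟩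

theorem exists_of_stepRel (h : IsCritical f R) {d : ZMod p} {a b : A} (hab : StepRel R d a b)
    (i : ZMod p) : ∃ r ∈ R, r i = a ∧ r (i + d) = b := by
  obtain ⟨r, hr, rfl, rfl⟩ := hab
  exact ⟨_, h.shift r hr (-i), by simp, by simp⟩

theorem stepRel_left_total (h : IsCritical f R) (d : ZMod p) (a : A) : ∃ b, StepRel R d a b := by
  obtain ⟨r, hr, rfl⟩ := h.proj_surjective 0 a
  exact ⟨_, r, hr, rfl, rfl⟩

theorem stepRel_right_total (h : IsCritical f R) (d : ZMod p) (b : A) : ∃ a, StepRel R d a b := by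
  obtain ⟨r, hr, rfl⟩ := h.proj_surjective d b
  exact ⟨_, r, hr, rfl, rfl⟩

theorem compat_stepRel (h : IsCritical f R) (d : ZMod p) : Compat f f (StepRel R d) := by
  intro x y hxy
  choose r hr hx hy using hxy
  exact ⟨piOp f r, h.closed r hr, congrArg f (funext hx), congrArg f (funext hy)⟩

theorem closedUnder_of_absorbs [Nonempty W] {Y : Type*} {g : (W → Y) → Y} {X C : Set Y}
    (hC : OpAbsorbs g X C) (hCX : C ⊆ X) : ClosedUnder g C :=
  fun x hx => hC x (Classical.arbitrary W) (hCX (hx _)) fun w _ => hx w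

/-- Distinct elements cannot all be separated by their successors at a nonzero distance. -/
theorem exists_common_successor [Fact p.Prime] [Finite A] (h : IsCritical f R)
    (hcard : Nat.card A < p) {d : ZMod p} (hd : d ≠ 0) :
    ¬ ∀ b c, (∃ e, StepRel R d b e ∧ StepRel R d c e) → b = c := by
  classical
  intro hinj
  cases nonempty_fintype A
  choose φ hφ using h.stepRel_right_total d
  have hstep : ∀ r ∈ R, ∀ i, r i = φ (r (i + d)) := fun r hr i =>
    hinj _ _ ⟨_, h.stepRel_apply hr i d, hφ _⟩
  have hiter : ∀ r ∈ R, ∀ (n : ℕ) i, r i = φ^[n] (r (i + n * d)) := by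
    intro r hr n
    induction n with
    | zero => simp
    | succ n ih =>
      intro i
      rw [Function.iterate_succ_apply, Nat.cast_succ, add_mul, one_mul, ← add_assoc,
        ← hstep r hr]
      exact ih i
  have hfix : ∀ b, φ b = b := by
    let ψ : Function.End A := φ
    have hψ : ψ ^ p ^ 1 = 1 := by
      rw [pow_one]
      funext b
      obtain ⟨r, hr, rfl⟩ := h.proj_surjective 0 b
      have := hiter r hr p 0
      rw [CharP.cast_eq_zero, zero_mul, add_zero] at this
      rw [end_pow_eq_iterate]
      exact this.symm
    have hmod := Equiv.Perm.card_fixedPoints_modEq hψ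
    have hle := Fintype.card_subtype_le (fun a => a ∈ Function.fixedPoints ψ)
    rw [Nat.card_eq_fintype_card] at hcard
    have heq : Fintype.card A = Fintype.card (Function.fixedPoints ψ) :=
      hmod.eq_of_lt_of_lt hcard (lt_of_le_of_lt hle hcard)
    intro b
    by_contra hb
    exact (Fintype.card_subtype_lt (p := fun a => a ∈ Function.fixedPoints ψ) hb).ne heq.symm
  obtain ⟨r, hr⟩ := h.nonempty
  refine h.no_const (r 0) ?_
  convert hr using 1
  funext i
  have hi := hiter r hr (i * d⁻¹).val 0
  rw [ZMod.natCast_zmod_val, mul_assoc, inv_mul_cancel₀ hd, mul_one, zero_add,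
    Function.iterate_fixed (hfix _)] at hi
  exact hi

/-- The entries of the first `k` coordinates of a tuple. -/
def initial (k : ℕ) (r : ZMod p → A) : Fin k → A := fun i => r (i : ℕ)

theorem eq_of_castSucc_of_last {k : ℕ} {g g' : Fin (k + 1) → A}
    (h₁ : (fun i : Fin k => g i.castSucc) = fun i => g' i.castSucc)
    (h₂ : g (Fin.last k) = g' (Fin.last k)) : g = g' := by
  funext i
  induction i using Fin.lastCases with
  | last => exact h₂
  | cast i => exact congrFun h₁ i

theorem initial_absorptionFree [Fact p.Prime] [Finite A] (h : IsCritical f R)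
    (hcard : Nat.card A < p) (hfree : FreeArgs f) (haf : AbsorptionFree f) (k : ℕ) :
    (∀ C ⊆ initial k '' R, C.Nonempty → OpAbsorbs (piOp f) (initial k '' R) C →
      C = initial k '' R) ∧ ¬ p ∣ (initial k '' R).ncard := by
  have := h.nonempty_carrier
  induction k with
  | zero =>
    have hsub : ∀ C : Set (Fin 0 → A), C.Nonempty → C = Set.univ := by
      rintro C ⟨c, hc⟩
      exact Set.eq_univ_of_forall fun g => Subsingleton.elim c g ▸ hc
    have h₀ := hsub _ (h.nonempty.image (initial 0))
    refine ⟨fun C _ hC _ => (hsub C hC).trans h₀.symm, ?_⟩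
    rw [h₀, Set.ncard_univ]
    simpa using (Fact.out : p.Prime).ne_one
  | succ k ih =>
    obtain ⟨ih, ihcard⟩ := ih
    set P := initial k '' R
    set Q := initial (k + 1) '' R
    let res : (Fin (k + 1) → A) → (Fin k → A) := fun g i => g i.castSucc
    have hQP : ∀ g ∈ Q, res g ∈ P := by
      rintro _ ⟨r, hr, rfl⟩
      exact ⟨r, hr, rfl⟩
    have hPQ : ∀ e ∈ P, ∃ g ∈ Q, res g = e := by
      rintro _ ⟨r, hr, rfl⟩
      exact ⟨_, ⟨r, hr, rfl⟩, rfl⟩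
    have hQclosed : ClosedUnder (piOp f) Q := by
      intro x hx
      choose r hr hrx using hx
      refine ⟨piOp f r, h.closed r hr, ?_⟩
      rw [← funext hrx]
      rfl
    have hres : ∀ C ⊆ Q, C.Nonempty → OpAbsorbs (piOp f) Q C → res '' C = P := by
      intro C hCQ hC habs
      refine ih _ (by rintro _ ⟨g, hg, rfl⟩; exact hQP g (hCQ hg)) (hC.image _) ?_
      intro x w₀ hx hxC
      have : ∀ w, ∃ g ∈ Q, res g = x w ∧ (w ≠ w₀ → g ∈ C) := by
        intro w
        by_cases hw : w = w₀
        · subst hw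
          obtain ⟨g, hg, hgx⟩ := hPQ _ hx
          exact ⟨g, hg, hgx, fun h => absurd rfl h⟩
        · obtain ⟨g, hg, hgx⟩ := hxC w hw
          exact ⟨g, hCQ hg, hgx, fun _ => hg⟩
      choose y hy hyx hyC using this
      refine ⟨piOp f y, habs y w₀ (hy _) hyC, ?_⟩
      rw [← funext hyx]
      rfl
    let S : (Fin k → A) → A → Prop := fun e a => ∃ g ∈ Q, res g = e ∧ g (Fin.last k) = a
    have hS : Compat (piOp f) f S := by
      intro x y hxy
      choose g hg hgx hgy using hxy
      refine ⟨piOp f g, hQclosed g hg, ?_, ?_⟩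
      · rw [← funext hgx]; rfl
      · rw [← funext hgy]; rfl
    let E : A → A → Prop := fun a b => ∃ e, S e a ∧ S e b
    have hE : Compat f f E := hS.swap.comp hS
    by_cases hEeq : ∀ a b, E a b → a = b
    · have hinj : ∀ g ∈ Q, ∀ g' ∈ Q, res g = res g' → g = g' := fun g hg g' hg' hgg =>
        eq_of_castSucc_of_last hgg (hEeq _ _ ⟨_, ⟨g, hg, rfl, rfl⟩, g', hg', hgg.symm, rfl⟩)
      constructor
      · intro C hCQ hC habs
        refine hCQ.antisymm fun g hg => ?_
        have : res g ∈ res '' C := hres C hCQ hC habs ▸ hQP g hg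
        obtain ⟨c, hc, hcg⟩ := this
        exact hinj c (hCQ hc) g hg hcg ▸ hc
      · have : res '' Q = P := Set.Subset.antisymm
          (by rintro _ ⟨g, hg, rfl⟩; exact hQP g hg) (fun e he => hPQ e he)
        rwa [← Set.InjOn.ncard_image (f := res) fun g hg g' hg' => hinj g hg g' hg', this]
    · have hfull := linked_full h.idem hfree haf h.simple E
        (fun a => by
          obtain ⟨r, hr, hra⟩ := h.proj_surjective (k : ℕ) a
          exact ⟨initial k r, ⟨_, ⟨r, hr, rfl⟩, rfl, hra⟩, _, ⟨r, hr, rfl⟩, rfl, hra⟩)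
        (fun a b ⟨e, h₁, h₂⟩ => ⟨e, h₂, h₁⟩) hE hEeq
      obtain ⟨e, he⟩ := exists_center h.idem hfree haf hS hfull
      have hSP : ∀ e a, S e a → e ∈ P := fun e a ⟨g, hg, hge, _⟩ => hge ▸ hQP g hg
      have hcen := ih {e | ∀ a, S e a} (fun e he => hSP e _ (he (Classical.arbitrary A))) ⟨e, he⟩
        (hfree.absorbs_center hS fun e he => by
          obtain ⟨g, hg, hge⟩ := hPQ e he
          exact ⟨_, g, hg, hge, rfl⟩)
      have hall : ∀ e ∈ P, ∀ a, S e a := fun e he => hcen.symm.subset he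
      constructor
      · intro C hCQ hC habs
        refine hCQ.antisymm fun g hg => ?_
        have hfib : {a | ∃ c ∈ C, res c = res g ∧ c (Fin.last k) = a} = Set.univ := by
          refine haf _ ?_ ?_
          · have : res g ∈ res '' C := hres C hCQ hC habs ▸ hQP g hg
            obtain ⟨c, hc, hcg⟩ := this
            exact ⟨_, c, hc, hcg, rfl⟩
          · intro x w₀ _ hx
            have : ∀ w, ∃ c ∈ Q, res c = res g ∧ c (Fin.last k) = x w ∧ (w ≠ w₀ → c ∈ C) := by
              intro w
              by_cases hw : w = w₀
              · obtain ⟨c, hc, hcg, hcx⟩ := hall _ (hQP g hg) (x w)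
                exact ⟨c, hc, hcg, hcx, fun h => absurd hw h⟩
              · obtain ⟨c, hc, hcg, hcx⟩ := hx w hw
                exact ⟨c, hCQ hc, hcg, hcx, fun _ => hc⟩
            choose y hy hyg hyx hyC using this
            refine ⟨piOp f y, habs y w₀ (hy _) hyC, ?_, congrArg f (funext hyx)⟩
            funext i
            refine (congrArg f (funext fun w => congrFun (hyg w) i)).trans (h.idem _)
        obtain ⟨c, hc, hcg, hcl⟩ := (hfib ▸ Set.mem_univ (g (Fin.last k)) :
          g (Fin.last k) ∈ {a | ∃ c ∈ C, res c = res g ∧ c (Fin.last k) = a})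
        exact eq_of_castSucc_of_last hcg hcl ▸ hc
      · let pair : (Fin (k + 1) → A) → (Fin k → A) × A := fun g => (res g, g (Fin.last k))
        have himg : pair '' Q = P ×ˢ Set.univ := by
          ext ⟨e, a⟩
          constructor
          · rintro ⟨g, hg, hga⟩
            obtain ⟨rfl, rfl⟩ := Prod.mk.inj hga
            exact ⟨hQP g hg, trivial⟩
          · rintro ⟨he, -⟩
            obtain ⟨g, hg, rfl, rfl⟩ := hall e he a
            exact ⟨g, hg, rfl⟩
        have hinj : Set.InjOn pair Q := fun g _ g' _ hgg =>
          eq_of_castSucc_of_last (congrArg Prod.fst hgg) (congrArg Prod.snd hgg)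
        rw [← hinj.ncard_image, himg, Set.ncard_prod, Set.ncard_univ,
          (Fact.out : p.Prime).dvd_mul, not_or]
        exact ⟨ihcard, Nat.not_dvd_of_pos_of_lt Nat.card_pos hcard⟩

theorem not_absorptionFree [Fact p.Prime] [Finite A] (h : IsCritical f R)
    (hcard : Nat.card A < p) (hfree : FreeArgs f) : ¬ AbsorptionFree f := by
  classical
  intro haf
  cases nonempty_fintype A
  apply (h.initial_absorptionFree hcard hfree haf p).2
  have hinj : Set.InjOn (initial p) R := by
    intro r _ r' _ hrr
    funext i
    have := congrFun hrr ⟨i.val, i.val_lt⟩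
    simpa [initial] using this
  rw [hinj.ncard_image, ← Nat.card_coe_set_eq, Nat.card_eq_fintype_card]
  let σ : Function.End R := fun r => ⟨fun i => r.1 (i + 1), h.shift _ r.2 1⟩
  have hσ : ∀ (n : ℕ) (r : R) i, ((σ ^ n) r).1 i = r.1 (i + n) := by
    intro n
    induction n with
    | zero => intro r i; rw [Nat.cast_zero, add_zero]; rfl
    | succ n ih =>
      intro r i
      rw [pow_succ]
      change ((σ ^ n) (σ r)).1 i = _
      rw [ih]
      simp [σ, add_assoc]
  have hσp : σ ^ p ^ 1 = 1 := by
    funext r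
    apply Subtype.ext
    funext i
    rw [pow_one, hσ, CharP.cast_eq_zero, add_zero]
    rfl
  have hmod := Equiv.Perm.card_fixedPoints_modEq hσp
  have hempty : IsEmpty (Function.fixedPoints σ) := by
    refine ⟨fun ⟨r, hr⟩ => h.no_const (r.1 0) ?_⟩
    convert r.2 using 1
    funext i
    have hfix : (σ ^ i.val) r = r := by
      rw [end_pow_eq_iterate]; exact Function.iterate_fixed hr _
    have := hσ i.val r 0
    rw [hfix] at this
    simpa using this
  rw [Fintype.card_eq_zero (α := Function.fixedPoints σ)] at hmod
  exact (Nat.modEq_zero_iff_dvd).1 hmod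

end IsCritical

end CyclicRelations

section Walks

variable {W : Type} {A : Type*} {p : ℕ}

/-- Walks of length `M` whose `m`-th step is taken along `Q m`. -/
def Walk (Q : ℕ → A → A → Prop) : ℕ → A → A → Prop
  | 0 => fun a b => a = b
  | M + 1 => fun a b => ∃ c, Walk Q M a c ∧ Q M c b

theorem walk_add {Q : ℕ → A → A → Prop} {M M' : ℕ} {a b : A} :
    Walk Q (M + M') a b ↔ ∃ c, Walk Q M a c ∧ Walk (fun j => Q (M + j)) M' c b := by
  induction M' generalizing b with
  | zero => simp [Walk]
  | succ M' ih =>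
    rw [← add_assoc]
    simp only [Walk, ih]
    constructor
    · rintro ⟨c, ⟨e, h₁, h₂⟩, h₃⟩
      exact ⟨e, h₁, c, h₂, h₃⟩
    · rintro ⟨e, h₁, c, h₂, h₃⟩
      exact ⟨c, ⟨e, h₁, h₂⟩, h₃⟩

theorem walk_left_total {Q : ℕ → A → A → Prop} (hQ : ∀ m a, ∃ b, Q m a b) (M : ℕ) (a : A) :
    ∃ b, Walk Q M a b := by
  induction M with
  | zero => exact ⟨a, rfl⟩
  | succ M ih =>
    obtain ⟨c, hc⟩ := ih
    obtain ⟨b, hb⟩ := hQ M c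
    exact ⟨b, c, hc, hb⟩

theorem walk_right_total {Q : ℕ → A → A → Prop} (hQ : ∀ m b, ∃ a, Q m a b) (M : ℕ) (b : A) :
    ∃ a, Walk Q M a b := by
  induction M generalizing b with
  | zero => exact ⟨b, rfl⟩
  | succ M ih =>
    obtain ⟨c, hc⟩ := hQ M b
    obtain ⟨a, ha⟩ := ih c
    exact ⟨a, c, ha, hc⟩

/-- A walk along `B` in every row but one, and along `G` in the remaining row, is mapped to a walk
along `B` when each `B m` absorbs `G m`. -/
theorem walk_absorb {f : (W → A) → A} {B G : ℕ → A → A → Prop}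
    (habs : ∀ m x y w₀, (∀ w, w ≠ w₀ → B m (x w) (y w)) → G m (x w₀) (y w₀) → B m (f x) (f y))
    (M : ℕ) (x y : W → A) (w₀ : W) (hB : ∀ w, w ≠ w₀ → Walk B M (x w) (y w))
    (hG : Walk G M (x w₀) (y w₀)) : Walk B M (f x) (f y) := by
  induction M generalizing y with
  | zero =>
    refine congrArg f (funext fun w => ?_)
    by_cases hw : w = w₀
    · subst hw; exact hG
    · exact hB w hw
  | succ M ih =>
    have : ∀ w, ∃ c, (w ≠ w₀ → Walk B M (x w) c ∧ B M c (y w)) ∧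
        (w = w₀ → Walk G M (x w) c ∧ G M c (y w)) := by
      intro w
      by_cases hw : w = w₀
      · subst hw
        obtain ⟨c, hc⟩ := hG
        exact ⟨c, fun h => absurd rfl h, fun _ => hc⟩
      · obtain ⟨c, hc⟩ := hB w hw
        exact ⟨c, fun _ => hc, fun h => absurd h hw⟩
    choose z hz hz₀ using this
    exact ⟨f z, ih z (fun w hw => (hz w hw).1) (hz₀ w₀ rfl).1,
      habs M z y w₀ (fun w hw => (hz w hw).2) (hz₀ w₀ rfl).2⟩

namespace IsCritical

variable {f : (W → A) → A} {R : Set (ZMod p → A)}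

theorem walk_along (h : IsCritical f R) (d : ℕ → ZMod p) {r : ZMod p → A} (hr : r ∈ R) {a : A}
    {m m' : ℕ} (hm : m ≤ m')
    (ha : Walk (fun j => StepRel R (d j)) m a (r (∑ j ∈ Finset.range m, d j))) :
    Walk (fun j => StepRel R (d j)) m' a (r (∑ j ∈ Finset.range m', d j)) := by
  induction m', hm using Nat.le_induction with
  | base => exact ha
  | succ m' _ ih =>
    refine ⟨_, ih, ?_⟩
    rw [Finset.sum_range_succ]
    exact h.stepRel_apply hr _ _

theorem exists_walk_full_from [Fact p.Prime] [Finite A] (h : IsCritical f R)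
    (hcard : Nat.card A < p) {d : ℕ → ZMod p} (hd : ∀ m, d m ≠ 0) (a : A) :
    ∃ M, ∀ b, Walk (fun j => StepRel R (d j)) M a b := by
  let S : ℕ → Set A := fun m => {b | Walk (fun j => StepRel R (d j)) m a b}
  let D : ℕ → ZMod p := fun m => ∑ j ∈ Finset.range m, d j
  obtain ⟨D₀, hD₀⟩ := Finite.exists_infinite_fiber D
  have hinf : (D ⁻¹' {D₀}).Infinite := Set.infinite_coe_iff.1 hD₀
  have hgrow : ∀ t : ℕ, ∃ m, D m = D₀ ∧ (S m = Set.univ ∨ t ≤ (S m).ncard) := by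
    intro t
    induction t with
    | zero =>
      obtain ⟨m, hm⟩ := hinf.nonempty
      exact ⟨m, hm, Or.inr (Nat.zero_le _)⟩
    | succ t ih =>
      obtain ⟨m, hm, hS | hS⟩ := ih
      · exact ⟨m, hm, Or.inl hS⟩
      by_cases huniv : S m = Set.univ
      · exact ⟨m, hm, Or.inl huniv⟩
      obtain ⟨m', hm', hlt⟩ := hinf.exists_gt m
      have hDD : D m = D m' := hm.trans hm'.symm
      have hsub : S m ⊆ S m' := by
        intro b hb
        obtain ⟨r, hr, rfl⟩ := h.proj_surjective (D m) b
        have := h.walk_along d hr hlt.le hb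
        change Walk _ m' a (r (D m')) at this
        rwa [← hDD] at this
      obtain ⟨b, hb, c, hc, e, hbe, hce⟩ := h.simple.exists_boundary
        (walk_left_total (fun m => h.stepRel_left_total (d m)) m a) huniv
        (fun b c => ∃ e, StepRel R (d m) b e ∧ StepRel R (d m) c e)
        (fun b => (h.stepRel_left_total (d m) b).imp fun e he => ⟨he, he⟩)
        (fun b c ⟨e, h₁, h₂⟩ => ⟨e, h₂, h₁⟩)
        ((h.compat_stepRel (d m)).comp (h.compat_stepRel (d m)).swap)
        (h.exists_common_successor hcard (hd m))
      have hcm' : c ∈ S m' := by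
        obtain ⟨r, hr, rfl, hre⟩ := h.exists_of_stepRel hce (D m)
        have := h.walk_along d hr (Nat.succ_le_of_lt hlt) (a := a) (by
          rw [Finset.sum_range_succ]
          change Walk _ (m + 1) a (r (D m + d m))
          rw [hre]
          exact ⟨b, hb, hbe⟩)
        change Walk _ m' a (r (D m')) at this
        rwa [← hDD] at this
      refine ⟨m', hm', Or.inr (Nat.succ_le_of_lt (lt_of_le_of_lt hS ?_))⟩
      exact Set.ncard_lt_ncard (Set.ssubset_iff_of_subset hsub |>.2 ⟨c, hcm', hc⟩)
  obtain ⟨m, -, hm | hm⟩ := hgrow (Nat.card A + 1)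
  · exact ⟨m, fun b => (hm ▸ Set.mem_univ b : b ∈ S m)⟩
  · exact absurd (hm.trans (Set.ncard_le_card _)) (by omega)

theorem exists_walk_full [Fact p.Prime] [Finite A] (h : IsCritical f R)
    (hcard : Nat.card A < p) {d : ℕ → ZMod p} (hd : ∀ m, d m ≠ 0) :
    ∃ M, ∀ a b, Walk (fun j => StepRel R (d j)) M a b := by
  choose M hM using h.exists_walk_full_from hcard hd
  obtain ⟨K, hK⟩ := (Set.finite_range M).bddAbove
  refine ⟨K, fun a b => ?_⟩
  obtain ⟨j, rfl⟩ := Nat.exists_eq_add_of_le (hK ⟨a, rfl⟩)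
  obtain ⟨c, hc⟩ := walk_right_total
    (fun i => h.stepRel_right_total (d (M a + i))) j b
  exact walk_add.2 ⟨c, hM a c, hc⟩

theorem exists_walk_op [Fact p.Prime] [Finite A] (h : IsCritical f R)
    (hcard : Nat.card A < p) (U : Finset W) (d : ℕ → ZMod p) (B : ℕ → A → A → Prop)
    (hd : ∀ m, d m ≠ 0) (hBl : ∀ m a, ∃ b, B m a b) (hBr : ∀ m b, ∃ a, B m a b)
    (habs : ∀ m x y w₀, (∀ w, w ≠ w₀ → B m (x w) (y w)) → StepRel R (d m) (x w₀) (y w₀) →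
      B m (f x) (f y)) :
    ∃ M, ∀ x y : W → A, (∀ w, w ∉ U → Walk B M (x w) (y w)) → Walk B M (f x) (f y) := by
  classical
  induction U using Finset.induction_on generalizing d B with
  | empty => exact ⟨0, fun x y hxy => congrArg f (funext fun w => hxy w (by simp))⟩
  | insert w₀ U hw₀ ih =>
    obtain ⟨M₁, hM₁⟩ := ih d B hd hBl hBr habs
    obtain ⟨M₂, hM₂⟩ := h.exists_walk_full hcard (d := fun j => d (M₁ + j)) fun m => hd _
    refine ⟨M₁ + M₂, fun x y hxy => walk_add.2 ?_⟩
    have : ∀ w, ∃ c, (w ∉ U → Walk B M₁ (x w) c) ∧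
        (w ≠ w₀ → Walk (fun j => B (M₁ + j)) M₂ c (y w)) := by
      intro w
      by_cases hw : w = w₀
      · obtain ⟨c, hc⟩ := walk_left_total hBl M₁ (x w)
        exact ⟨c, fun _ => hc, fun h => absurd hw h⟩
      by_cases hwU : w ∈ U
      · obtain ⟨c, hc⟩ := walk_right_total (fun j => hBr (M₁ + j)) M₂ (y w)
        exact ⟨c, fun h => absurd hwU h, fun _ => hc⟩
      · obtain ⟨c, hc⟩ := walk_add.1 (hxy w (by simp [hw, hwU]))
        exact ⟨c, fun _ => hc.1, fun _ => hc.2⟩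
    choose z hz₁ hz₂ using this
    exact ⟨f z, hM₁ x z hz₁,
      walk_absorb (fun m => habs (M₁ + m)) M₂ z y w₀ hz₂ (hM₂ _ _)⟩

theorem exists_absorbing_step [Nonempty W] [Fact p.Prime] (h : IsCritical f R) {X : Set A}
    (hX : X.Nonempty) (hX' : X ≠ Set.univ) (habs : OpAbsorbs f Set.univ X) :
    ∃ X' : Set A, ∃ d : ZMod p, ∃ B : A → A → Prop,
      (X'.Nonempty ∧ X' ≠ Set.univ ∧ OpAbsorbs f Set.univ X') ∧ d ≠ 0 ∧
      (∀ a, ∃ b, B a b) ∧ (∀ b, ∃ a, B a b) ∧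
      (∀ x y w₀, (∀ w, w ≠ w₀ → B (x w) (y w)) → StepRel R d (x w₀) (y w₀) → B (f x) (f y)) ∧
      ∀ a ∈ X, ∀ b, B a b → b ∈ X' := by
  classical
  have hXclosed : ClosedUnder f X := closedUnder_of_absorbs habs (Set.subset_univ _)
  let bad : Finset (ZMod p) → Prop := fun I =>
    ∃ j, j ∉ I ∧ ∃ b, ∀ r ∈ R, (∀ l ∈ I, r l ∈ X) → r j ≠ b
  have hbad : ∃ I, bad I := by
    by_contra hno
    have hall : ∀ I : Finset (ZMod p), ∃ r ∈ R, ∀ l ∈ I, r l ∈ X := by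
      intro I
      induction I using Finset.induction_on with
      | empty => exact h.nonempty.imp fun r hr => ⟨hr, by simp⟩
      | insert j I hj ih =>
        by_contra hn
        obtain ⟨b, hb⟩ := hX
        refine hno ⟨I, j, hj, b, fun r hr hrI hrb => hn ⟨r, hr, fun l hl => ?_⟩⟩
        rcases Finset.mem_insert.1 hl with rfl | hl
        · rwa [hrb]
        · exact hrI l hl
    obtain ⟨r, hr, hrX⟩ := hall Finset.univ
    exact hX' (h.sub X hXclosed r hr fun i => hrX i (Finset.mem_univ i))
  obtain ⟨I, ⟨j, hj, b₀, hb₀⟩, hmin⟩ := wellFounded_lt.has_min {I | bad I} hbad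
  have hI : I.Nonempty := by
    rw [Finset.nonempty_iff_ne_empty]
    rintro rfl
    obtain ⟨r, hr, hrb⟩ := h.proj_surjective j b₀
    exact hb₀ r hr (by simp) hrb
  obtain ⟨i, hi⟩ := hI
  have hgood : ∀ j, j ∉ I.erase i → ∀ b, ∃ r ∈ R, (∀ l ∈ I.erase i, r l ∈ X) ∧ r j = b := by
    intro j hj b
    by_contra hn
    exact hmin (I.erase i) ⟨j, hj, b, fun r hr hrI hrb => hn ⟨r, hr, hrI, hrb⟩⟩
      (Finset.erase_ssubset hi)
  have hjI : j ∉ I.erase i := fun hj' => hj (Finset.mem_of_mem_erase hj')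
  have hsplit : ∀ r : ZMod p → A, r i ∈ X → (∀ l ∈ I.erase i, r l ∈ X) → ∀ l ∈ I, r l ∈ X := by
    intro r hri hr l hl
    by_cases hli : l = i
    · rwa [hli]
    · exact hr l (Finset.mem_erase.2 ⟨hli, hl⟩)
  refine ⟨{b | ∃ r ∈ R, (∀ l ∈ I, r l ∈ X) ∧ r j = b}, j - i,
    fun a b => ∃ r ∈ R, (∀ l ∈ I.erase i, r l ∈ X) ∧ r i = a ∧ r j = b,
    ⟨?_, ?_, ?_⟩, ?_, ?_, ?_, ?_, ?_⟩
  · obtain ⟨a, ha⟩ := hX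
    obtain ⟨r, hr, hrI, rfl⟩ := hgood i (Finset.notMem_erase i I) a
    exact ⟨r j, r, hr, hsplit r ha hrI, rfl⟩
  · intro huniv
    obtain ⟨r, hr, hrI, hrb⟩ := (huniv ▸ Set.mem_univ b₀ :
      b₀ ∈ {b | ∃ r ∈ R, (∀ l ∈ I, r l ∈ X) ∧ r j = b})
    exact hb₀ r hr hrI hrb
  · intro x w₀ _ hx
    have : ∀ w, ∃ r ∈ R, (w ≠ w₀ → ∀ l ∈ I, r l ∈ X) ∧ r j = x w := by
      intro w
      by_cases hw : w = w₀
      · obtain ⟨r, hr, hrx⟩ := h.proj_surjective j (x w)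
        exact ⟨r, hr, fun h => absurd hw h, hrx⟩
      · obtain ⟨r, hr, hrI, hrx⟩ := hx w hw
        exact ⟨r, hr, fun _ => hrI, hrx⟩
    choose r hr hrI hrx using this
    exact ⟨piOp f r, h.closed r hr,
      fun l hl => habs _ w₀ (Set.mem_univ _) fun w hw => hrI w hw l hl, congrArg f (funext hrx)⟩
  · exact sub_ne_zero.2 fun hji => hj (hji ▸ hi)
  · intro a
    obtain ⟨r, hr, hrI, hra⟩ := hgood i (Finset.notMem_erase i I) a
    exact ⟨r j, r, hr, hrI, hra, rfl⟩
  · intro b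
    obtain ⟨r, hr, hrI, hrb⟩ := hgood j hjI b
    exact ⟨r i, r, hr, hrI, rfl, hrb⟩
  · intro x y w₀ hB hG
    have : ∀ w, ∃ r ∈ R, (w ≠ w₀ → ∀ l ∈ I.erase i, r l ∈ X) ∧ r i = x w ∧ r j = y w := by
      intro w
      by_cases hw : w = w₀
      · subst hw
        obtain ⟨r, hr, hrx, hry⟩ := h.exists_of_stepRel hG i
        exact ⟨r, hr, fun h => absurd rfl h, hrx, by rwa [add_sub_cancel] at hry⟩
      · obtain ⟨r, hr, hrI, hrx, hry⟩ := hB w hw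
        exact ⟨r, hr, fun _ => hrI, hrx, hry⟩
    choose r hr hrI hrx hry using this
    exact ⟨piOp f r, h.closed r hr,
      fun l hl => habs _ w₀ (Set.mem_univ _) fun w hw => hrI w hw l hl,
      congrArg f (funext hrx), congrArg f (funext hry)⟩
  · rintro a ha b ⟨r, hr, hrI, rfl, rfl⟩
    exact ⟨r, hr, hsplit r ha hrI, rfl⟩

theorem absorptionFree [Finite W] [Nonempty W] [Fact p.Prime] [Finite A] (h : IsCritical f R)
    (hcard : Nat.card A < p) : AbsorptionFree f := by
  intro X₀ hX₀ habs₀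
  cases nonempty_fintype W
  by_contra hne₀
  let T := {X : Set A // X.Nonempty ∧ X ≠ Set.univ ∧ OpAbsorbs f Set.univ X}
  have hstep := fun X : T => h.exists_absorbing_step X.2.1 X.2.2.1 X.2.2.2
  choose next d B hnext hd hBl hBr habs hmem using hstep
  let X : ℕ → T := fun n => Nat.rec ⟨X₀, hX₀, hne₀, habs₀⟩ (fun _ Y => ⟨next Y, hnext Y⟩) n
  obtain ⟨M, hM⟩ := h.exists_walk_op hcard Finset.univ (fun m => d (X m)) (fun m => B (X m))
    (fun m => hd _) (fun m => hBl _) (fun m => hBr _) (fun m => habs _)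
  have hstay : ∀ m, ∀ a ∈ X₀, ∀ b, Walk (fun m => B (X m)) m a b → b ∈ (X m).1 := by
    intro m
    induction m with
    | zero => rintro a ha b rfl; exact ha
    | succ m ih =>
      rintro a ha b ⟨c, hc, hcb⟩
      exact hmem (X m) c (ih a ha c hc) b hcb
  obtain ⟨a, ha⟩ := hX₀
  refine (X M).2.2.1 (Set.eq_univ_of_forall fun b => hstay M a ha b ?_)
  have := hM (fun _ => a) (fun _ => b) (by simp)
  rwa [h.idem, h.idem] at this

end IsCritical

end Walks

section ConstantTuples

universe u

/-- An idempotent operation invariant under a transitive group of permutations of its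
arguments. -/
structure IsTransitiveOp {W : Type} {A : Type*} (f : (W → A) → A) : Prop where
  idem : ∀ a, f (fun _ => a) = a
  symm : ∀ w w', ∃ σ : Equiv.Perm W, σ w = w' ∧ ∀ x : W → A, f (x ∘ σ) = f x

/-- Over an algebra with `c` elements and a transitive operation, every nonempty shift-invariant
relation of arity `p` has a constant tuple. -/
def ConstantTupleProperty (p c : ℕ) : Prop :=
  ∀ (A : Type u) [Finite A] (W : Type) [Finite W] [Nontrivial W] (f : (W → A) → A)
    (R : Set (ZMod p → A)), Nat.card A = c → IsTransitiveOp f → ClosedUnder (piOp f) R →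
    (∀ r ∈ R, ∀ s, (fun i => r (i + s)) ∈ R) → R.Nonempty → ∃ a, (fun _ => a) ∈ R

variable {p : ℕ} {A : Type u} {W : Type}

theorem isCritical_of_constantTupleProperty [Finite A] [Finite W] [Nontrivial W]
    (ih : ∀ c < Nat.card A, ConstantTupleProperty.{u} p c) {f : (W → A) → A}
    {R : Set (ZMod p → A)} (hf : IsTransitiveOp f) (hclosed : ClosedUnder (piOp f) R)
    (hshift : ∀ r ∈ R, ∀ s, (fun i => r (i + s)) ∈ R) (hne : R.Nonempty)
    (hno : ∀ a, (fun _ => a) ∉ R) : IsCritical f R := by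
  have hsub : ∀ C : Set A, ClosedUnder f C → ∀ r ∈ R, (∀ i, r i ∈ C) → C = Set.univ := by
    intro C hC r hr hrC
    by_contra hCne
    let g : (W → C) → C := fun x => ⟨f fun w => x w, hC _ fun w => (x w).2⟩
    obtain ⟨a, ha⟩ := ih (Nat.card C)
      (by rw [Nat.card_coe_set_eq, ← Set.ncard_univ]
          exact Set.ncard_lt_ncard (Set.ssubset_univ_iff.2 hCne))
      C W g {r | (fun i => (r i : A)) ∈ R} rfl
      ⟨fun a => Subtype.ext (hf.idem a), fun w w' => (hf.symm w w').imp fun σ hσ =>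
        ⟨hσ.1, fun x => Subtype.ext (hσ.2 fun w => x w)⟩⟩
      (fun x hx => hclosed _ hx) (fun r hr s => hshift _ hr s) ⟨fun i => ⟨r i, hrC i⟩, hr⟩
    exact hno a ha
  refine ⟨hf.idem, hclosed, hshift, hne, hno, hsub, fun E hE hcompat => ?_⟩
  by_contra! hEne
  obtain ⟨⟨a₀, b₀, hab₀, hne₀⟩, a₁, b₁, hab₁⟩ := hEne
  let s : Setoid A := ⟨E, hE⟩
  let g : (W → Quotient s) → Quotient s := fun q => ⟦f fun w => (q w).out⟧
  have hg : ∀ x : W → A, g (fun w => ⟦x w⟧) = ⟦f x⟧ := fun x =>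
    Quotient.sound (hcompat _ _ fun w => Quotient.mk_out (x w))
  have hlt : Nat.card (Quotient s) < Nat.card A := by
    refine lt_of_le_of_ne (Nat.card_le_card_of_surjective _ Quotient.mk_surjective) fun heq => ?_
    have hbij := (Nat.bijective_iff_surjective_and_card (Quotient.mk s)).2
      ⟨Quotient.mk_surjective, heq.symm⟩
    exact hne₀ (hbij.1 (Quotient.sound hab₀))
  obtain ⟨q, r, hr, hrq⟩ := ih _ hlt (Quotient s) W g ((fun r i => (⟦r i⟧ : Quotient s)) '' R) rfl
    ⟨fun q => by simp only [g, hf.idem, Quotient.out_eq], fun w w' => (hf.symm w w').imp fun σ hσ =>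
        ⟨hσ.1, fun x => congrArg (Quotient.mk s) (hσ.2 fun w => (x w).out)⟩⟩
    (by
      intro x hx
      choose r hr hrx using hx
      refine ⟨piOp f r, hclosed r hr, ?_⟩
      rw [← funext hrx]
      exact funext fun i => (hg fun w => r w i).symm)
    (by
      rintro _ ⟨r, hr, rfl⟩ s
      exact ⟨_, hshift r hr s, rfl⟩)
    (hne.image _)
  have hrE : ∀ i, E (r i) q.out := fun i => by
    have := congrFun hrq i
    rw [← Quotient.out_eq q] at this
    exact Quotient.exact this
  have huniv := hsub {a | E a q.out}
    (fun x hx => by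
      have := hcompat x (fun _ => q.out) hx
      rwa [hf.idem] at this) r hr hrE
  have hmem : ∀ a, E a q.out := fun a => (huniv ▸ Set.mem_univ a : a ∈ {a | E a q.out})
  exact hab₁ (hE.trans (hmem a₁) (hE.symm (hmem b₁)))

/-- The composition `f (g, …, g)` on the product index set. -/
def prodOp {V : Type} (f : (W → A) → A) (g : (V → A) → A) : (W × V → A) → A :=
  fun x => f fun w => g fun v => x (w, v)

theorem IsTransitiveOp.prodOp {V : Type} {f : (W → A) → A} {g : (V → A) → A}
    (hf : IsTransitiveOp f) (hg : IsTransitiveOp g) : IsTransitiveOp (prodOp f g) := by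
  refine ⟨fun a => by simp only [_root_.prodOp, hf.idem, hg.idem], ?_⟩
  rintro ⟨w, v⟩ ⟨w', v'⟩
  obtain ⟨σ, hσ, hσf⟩ := hf.symm w w'
  obtain ⟨τ, hτ, hτg⟩ := hg.symm v v'
  refine ⟨σ.prodCongr τ, Prod.ext hσ hτ, fun x => ?_⟩
  have h₁ : ∀ w, (g fun v => x (σ w, τ v)) = g fun v => x (σ w, v) := fun w =>
    hτg fun v => x (σ w, v)
  change (f fun w => g fun v => x (σ w, τ v)) = f fun w => g fun v => x (w, v)
  simp only [h₁]
  exact hσf fun w => g fun v => x (w, v)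

/-- A nonempty set containing the values of `f` at all arguments with an entry in it is
everything. -/
theorem IsCritical.ideal_eq_univ [NeZero p] [Finite A] [Nontrivial W] {f : (W → A) → A}
    {R : Set (ZMod p → A)} (h : IsCritical f R) {I : Set A} (hI : I.Nonempty)
    (hideal : ∀ x w, x w ∈ I → f x ∈ I) : I = Set.univ := by
  obtain ⟨w₁, w₂, hw⟩ := exists_pair_ne W
  obtain ⟨a, ha⟩ := hI
  obtain ⟨r₀, hr₀, rfl⟩ := h.proj_surjective 0 a
  let supp : (ZMod p → A) → Set (ZMod p) := fun r => {i | r i ∈ I}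
  obtain ⟨r, hr, hmax⟩ := Set.exists_max_image R (fun r => (supp r).ncard) (Set.toFinite R)
    ⟨r₀, hr₀⟩
  have hne : (supp r).Nonempty := by
    rw [← Set.ncard_pos]
    exact lt_of_lt_of_le ((Set.ncard_pos).2 ⟨0, ha⟩) (hmax r₀ hr₀)
  obtain ⟨i₀, hi₀⟩ := hne
  refine h.sub I (fun x hx => hideal x w₁ (hx w₁)) r hr fun i => ?_
  classical
  let y : W → ZMod p → A := fun w => if w = w₁ then r else fun j => r (j + (i₀ - i))
  have hyR : piOp f y ∈ R := h.closed y fun w => by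
    by_cases hw : w = w₁
    · simpa [y, hw] using hr
    · simpa [y, hw] using h.shift r hr (i₀ - i)
  have hsub : supp r ⊆ supp (piOp f y) := fun j hj => hideal _ w₁ (by simpa [y, supp] using hj)
  have heq := Set.eq_of_subset_of_ncard_le hsub (hmax _ hyR)
  change i ∈ supp r
  rw [heq]
  exact hideal _ w₂ (by simpa [y, supp, hw.symm] using hi₀)

/-- The pairs `(a, b)` such that the value `b` is attained while any one argument is prescribed
to be `a`. -/
def freePairs (f : (W → A) → A) : Set (A × A) :=
  {q | ∀ w₀, ∃ x, x w₀ = q.1 ∧ f x = q.2}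

theorem exists_freeArgs [NeZero p] [Finite A] [Finite W] [Nontrivial W] {f : (W → A) → A}
    {R : Set (ZMod p → A)} (hf : IsTransitiveOp f) (h : IsCritical f R) :
    ∃ (V : Type) (_ : Finite V) (_ : Nontrivial V) (g : (V → A) → A),
      IsTransitiveOp g ∧ ClosedUnder (piOp g) R ∧ FreeArgs g := by
  let P : ℕ → Prop := fun n => ∃ (V : Type) (_ : Finite V) (_ : Nontrivial V) (g : (V → A) → A),
      IsTransitiveOp g ∧ ClosedUnder (piOp g) R ∧ (freePairs g).ncard = n
  have hbdd : ∀ n, P n → n ≤ Nat.card (A × A) := by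
    rintro n ⟨V, _, _, g, -, -, rfl⟩
    exact Set.ncard_le_card _
  obtain ⟨n, hn, hmax⟩ := (Set.finite_iff_bddAbove.2 ⟨_, hbdd⟩ : {n | P n}.Finite).exists_maximal
    ⟨_, W, inferInstance, inferInstance, f, hf, h.closed, rfl⟩
  obtain ⟨V, _, _, g, hg, hgR, rfl⟩ := hn
  refine ⟨V, inferInstance, inferInstance, g, hg, hgR, ?_⟩
  have hsub : freePairs g ⊆ freePairs (prodOp f g) := by
    rintro ⟨a, b⟩ hab ⟨w, v⟩
    obtain ⟨x, hx, hxb⟩ := hab v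
    exact ⟨fun i => x i.2, hx, by simpa only [prodOp, h.idem] using hxb⟩
  have heq : freePairs g = freePairs (prodOp f g) :=
    Set.eq_of_subset_of_ncard_le hsub
      (hmax ⟨W × V, inferInstance, inferInstance, _, hf.prodOp hg,
        fun x hx => h.closed _ fun w => hgR _ fun v => hx (w, v), rfl⟩
        (Set.ncard_le_ncard hsub))
  have hideal : ∀ a, {b | (a, b) ∈ freePairs g} = Set.univ := by
    intro a
    refine h.ideal_eq_univ ⟨a, fun v => ⟨fun _ => a, rfl, hg.idem a⟩⟩ fun x w hxw => ?_
    change (a, f x) ∈ freePairs g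
    rw [heq]
    rintro ⟨w₀, v₀⟩
    obtain ⟨σ, hσ, hσf⟩ := hf.symm w₀ w
    obtain ⟨y, hy, hyx⟩ := hxw v₀
    classical
    refine ⟨fun i => if i.1 = w₀ then y i.2 else x (σ i.1), by simpa using hy, ?_⟩
    rw [← hσf x]
    refine congrArg f (funext fun w' => ?_)
    by_cases hw' : w' = w₀
    · subst hw'
      simpa [hσ] using hyx
    · simpa [hw'] using hg.idem (x (σ w'))
  intro v a b
  exact (hideal a ▸ Set.mem_univ b : b ∈ {b | (a, b) ∈ freePairs g}) v

theorem constantTupleProperty [Fact p.Prime] (c : ℕ) (hc : c < p) :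
    ConstantTupleProperty.{u} p c := by
  induction c using Nat.strong_induction_on with
  | _ c ih =>
  rintro A _ W _ _ f R rfl hf hclosed hshift hne
  by_contra! hno
  have ih' := fun c' (hc' : c' < Nat.card A) => ih c' hc' (hc'.trans hc)
  obtain ⟨V, _, _, g, hg, hgR, hfree⟩ := exists_freeArgs hf
    (isCritical_of_constantTupleProperty ih' hf hclosed hshift hne hno)
  have hcrit := isCritical_of_constantTupleProperty ih' hg hgR hshift hne hno
  exact hcrit.not_absorptionFree hc hfree (hcrit.absorptionFree hc)

end ConstantTuples

section Polymorphisms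

theorem exists_iterate_idempotent {B : Type*} [Finite B] (e : B → B) :
    ∃ k, 1 ≤ k ∧ e^[k + k] = e^[k] := by
  obtain ⟨i, j, hij, heq⟩ : ∃ i j, i < j ∧ e^[i] = e^[j] := by
    obtain ⟨i, j, hne, heq⟩ := Finite.exists_ne_map_eq_of_infinite fun n : ℕ => e^[n]
    rcases lt_or_gt_of_ne hne with h | h
    · exact ⟨i, j, h, heq⟩
    · exact ⟨j, i, h, heq.symm⟩
  obtain ⟨d, rfl⟩ := Nat.exists_eq_add_of_lt hij
  have hstep : ∀ m, i ≤ m → ∀ q, e^[m + q * (d + 1)] = e^[m] := by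
    intro m hm q
    obtain ⟨l, rfl⟩ := Nat.exists_eq_add_of_le hm
    induction q with
    | zero => simp
    | succ q ih =>
      have h₁ : i + l + (q + 1) * (d + 1) = (l + q * (d + 1)) + (i + d + 1) := by ring
      have h₂ : i + l + q * (d + 1) = (l + q * (d + 1)) + i := by ring
      rw [h₁, Function.iterate_add, ← heq, ← Function.iterate_add, ← h₂, ih]
  refine ⟨(i + 1) * (d + 1), Nat.mul_pos (Nat.succ_pos i) (Nat.succ_pos d), hstep _ ?_ _⟩
  nlinarith

variable {B : Type*} {n p : ℕ}

theorem IsCyclicOp.comp_pow {f : (Fin n → B) → B} (hf : IsCyclicOp n f) (j : ℕ) (x : Fin n → B) :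
    f (x ∘ (finRotate n ^ j : Equiv.Perm (Fin n))) = f x := by
  induction j with
  | zero => rfl
  | succ j ih =>
    rw [pow_succ, Equiv.Perm.coe_mul, ← Function.comp_assoc, hf, ih]

theorem finRotate_pow_self (hn : 2 ≤ n) : finRotate n ^ n = 1 := by
  have h := (isCycle_finRotate_of_le hn).orderOf
  rw [support_finRotate_of_le hn, Finset.card_univ, Fintype.card_fin] at h
  rw [← orderOf_dvd_iff_pow_eq_one, h]

theorem exists_finRotate_pow_eq (hn : 2 ≤ n) (w w' : Fin n) : ∃ j : ℕ, (finRotate n ^ j) w = w' := by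
  have hsupp := support_finRotate_of_le hn
  refine (isCycle_finRotate_of_le hn).exists_pow_eq ?_ ?_ <;>
  · rw [← Equiv.Perm.mem_support, hsupp]
    exact Finset.mem_univ _

/-- A nonempty shift-invariant relation preserved by a cyclic operation has a constant tuple. -/
theorem IsCyclicOp.exists_const_mem [Finite B] [Fact p.Prime] (hB : Nat.card B < p) (hn : 2 ≤ n)
    {t : (Fin n → B) → B} (ht : IsCyclicOp n t) {R : Set (ZMod p → B)}
    (hR : ClosedUnder (piOp t) R) (hshift : ∀ r ∈ R, ∀ s, (fun i => r (i + s)) ∈ R)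
    (hne : R.Nonempty) : ∃ a, (fun _ => a) ∈ R := by
  let e : B → B := fun a => t fun _ => a
  obtain ⟨k, hk, hkk⟩ := exists_iterate_idempotent e
  have heR : ∀ j, ∀ r ∈ R, (fun i => e^[j] (r i)) ∈ R := by
    intro j
    induction j with
    | zero => exact fun r hr => hr
    | succ j ih => exact fun r hr => ih _ (hR (fun _ => r) fun _ => hr)
  let D : Set B := Set.range e^[k]
  obtain ⟨l, rfl⟩ := Nat.exists_eq_add_of_le' hk
  let g : (Fin n → D) → D := fun x =>
    ⟨e^[l + 1 + l] (t fun w => x w), e^[l] (t fun w => x w), by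
      rw [← Function.iterate_add_apply]⟩
  have hg : IsTransitiveOp g := by
    refine ⟨?_, fun w w' => ?_⟩
    · rintro ⟨_, b, rfl⟩
      refine Subtype.ext ?_
      change e^[l + 1 + l] (e (e^[l + 1] b)) = e^[l + 1] b
      rw [← Function.iterate_succ_apply, ← Function.iterate_add_apply]
      change e^[(l + 1 + (l + 1)) + (l + 1)] b = _
      rw [Function.iterate_add, hkk, ← Function.iterate_add, hkk]
    · obtain ⟨j, hj⟩ := exists_finRotate_pow_eq hn w w'
      exact ⟨_, hj, fun x => Subtype.ext (congrArg e^[l + 1 + l] (ht.comp_pow j fun w => x w))⟩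
  have : Nontrivial (Fin n) := Fin.nontrivial_iff_two_le.2 hn
  obtain ⟨r, hr⟩ := hne
  obtain ⟨a, ha⟩ := constantTupleProperty (p := p) (Nat.card D)
    (lt_of_le_of_lt (Finite.card_subtype_le _) hB) D (Fin n) g {r | (fun i => (r i : B)) ∈ R} rfl hg
    (fun x hx => heR _ _ (hR _ hx)) (fun r hr s => hshift _ hr s)
    ⟨fun i => ⟨e^[l + 1] (r i), r i, rfl⟩, heR _ r hr⟩
  exact ⟨a, ha⟩

variable {ι : Type*} {m : ι → ℕ} {R : ∀ i, Set (Fin (m i) → B)}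

theorem IsPolymorphism.comp_s15 {q : ℕ} {t : (Fin n → B) → B} (ht : IsPolymorphism m R n t)
    {h : Fin n → (Fin q → B) → B} (hh : ∀ w, IsPolymorphism m R q (h w)) :
    IsPolymorphism m R q fun y => t fun w => h w y :=
  fun i x hx => ht i (fun w j => h w fun k => x k j) fun w => hh w i x hx

theorem IsPolymorphism.comp_perm {h : (Fin n → B) → B} (hh : IsPolymorphism m R n h)
    (σ : Equiv.Perm (Fin n)) : IsPolymorphism m R n fun y => h (y ∘ σ) :=
  fun i x hx => hh i (fun k => x (σ k)) fun _ => hx _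

theorem exists_isPolymorphism_cyclic_on [Finite B] [hp : Fact p.Prime] (hB : Nat.card B < p)
    (hn : 2 ≤ n) {t : (Fin n → B) → B} (htp : IsPolymorphism m R n t) (ht : IsCyclicOp n t)
    (T : Finset (Fin p → B)) :
    ∃ h, IsPolymorphism m R p h ∧
      ∀ x ∈ T, ∀ j : ℕ, h (x ∘ (finRotate p ^ j : Equiv.Perm (Fin p))) = h x := by
  classical
  induction T using Finset.induction_on with
  | empty => exact ⟨fun x => x ⟨0, hp.out.pos⟩, fun i x hx => hx _, by simp⟩
  | insert x T _ ih =>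
    let Good : ((Fin p → B) → B) → Prop := fun h => IsPolymorphism m R p h ∧
      ∀ x ∈ T, ∀ j : ℕ, h (x ∘ (finRotate p ^ j : Equiv.Perm (Fin p))) = h x
    let tup : ((Fin p → B) → B) → ZMod p → B := fun h i =>
      h (x ∘ (finRotate p ^ i.val : Equiv.Perm (Fin p)))
    have hpow := finRotate_pow_self hp.out.two_le
    obtain ⟨a, h, hh, ha⟩ := ht.exists_const_mem hB hn (R := tup '' {h | Good h})
      (by
        intro y hy
        choose h hh hy using hy
        refine ⟨fun z => t fun w => h w z, ⟨htp.comp_s15 fun w => (hh w).1, fun z hz j => ?_⟩, ?_⟩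
        · exact congrArg t (funext fun w => (hh w).2 z hz j)
        · rw [← funext hy]
          rfl)
      (by
        rintro _ ⟨h, hh, rfl⟩ s
        refine ⟨fun z => h (z ∘ (finRotate p ^ s.val : Equiv.Perm (Fin p))),
          ⟨hh.1.comp_perm _, fun z hz j => ?_⟩, funext fun i => ?_⟩
        · change h (z ∘ _ ∘ _) = _
          rw [← Equiv.Perm.coe_mul, ← pow_add, hh.2 z hz]
          exact (hh.2 z hz _).symm
        · change h (x ∘ _ ∘ _) = h (x ∘ _)
          rw [← Equiv.Perm.coe_mul, ← pow_add, ZMod.val_add, ← pow_eq_pow_mod _ hpow])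
      (Set.Nonempty.image tup ih)
    refine ⟨h, hh.1, fun y hy j => ?_⟩
    rcases Finset.mem_insert.1 hy with rfl | hy
    · have hval : ∀ i : ZMod p, h (y ∘ (finRotate p ^ i.val : Equiv.Perm (Fin p))) = a :=
        fun i => congrFun ha i
      have hj := hval (j : ℕ)
      have h₀ := hval 0
      rw [ZMod.val_natCast, ← pow_eq_pow_mod _ hpow] at hj
      rw [ZMod.val_zero, pow_zero] at h₀
      exact hj.trans h₀.symm
    · exact hh.2 y hy j

end Polymorphisms

/-- For a finite relational structure on a set `B` of `N` elements, having a cyclic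
polymorphism of some arity `n ≥ 2` is equivalent to having a `p`-ary cyclic polymorphism
for every prime `p > N`. -/
theorem cyclic_polymorphism_iff_all_large_primes {B : Type*} [Fintype B]
    {ι : Type*} (m : ι → ℕ) (R : ∀ i : ι, Set (Fin (m i) → B))
    {N : ℕ} (hN : Fintype.card B = N) :
    (∃ n : ℕ, 2 ≤ n ∧ ∃ f : (Fin n → B) → B, IsPolymorphism m R n f ∧ IsCyclicOp n f) ↔
    (∀ p : ℕ, p.Prime → N < p →
      ∃ f : (Fin p → B) → B, IsPolymorphism m R p f ∧ IsCyclicOp p f) := by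
  classical
  constructor
  · rintro ⟨n, hn, t, htp, ht⟩ p hp hNp
    have : Fact p.Prime := ⟨hp⟩
    obtain ⟨h, hh, hcyc⟩ := exists_isPolymorphism_cyclic_on
      (by rwa [Nat.card_eq_fintype_card, hN]) hn htp ht (Finset.univ : Finset (Fin p → B))
    exact ⟨h, hh, fun x => by simpa using hcyc x (Finset.mem_univ x) 1⟩
  · intro h
    obtain ⟨p, hp, hprime⟩ := Nat.exists_infinite_primes (N + 1)
    exact ⟨p, hprime.two_le, h p hprime hp⟩
end
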